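/- For the Euclidean control system with Hamiltonians H_u(q,p) = |p|²/2 + V_0(q) + Σ_{j=1}^d u_j q_j + u_{d+1} e^{−|q|²/2}, every vertical shear (q,p) ↦ (q, p − ∇f(q)) with f ∈ C^∞(ℝ^d, ℝ) is small-time approximately reachable. -/

import Mathlib

open MeasureTheory Real

noncomputable section

/-- The phase space `T*ℝ^d = ℝ^d × ℝ^d` (positions `q` and momenta `p`),
identified with `ℝ^{2d}` with the sup norm and the Lebesgue (symplectic volume) measure. -/
abbrev Phase (d : ℕ) := (Fin d → ℝ) × (Fin d → ℝ)

/-- The Hamiltonian vector field of a function `H : Phase d → ℝ`: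
`H⃗(q,p) = (∂_p H(q,p), −∂_q H(q,p))`. -/
def hamVF {d : ℕ} (H : Phase d → ℝ) (x : Phase d) : Phase d :=
  (fun i => fderiv ℝ H x (0, Pi.single i 1),
   fun i => -(fderiv ℝ H x (Pi.single i 1, 0)))

/-- `φ` is the global flow of the (complete) vector field `X`. -/
def IsFlowOf {d : ℕ} (X : Phase d → Phase d) (φ : ℝ → Phase d → Phase d) : Prop :=
  (∀ x, φ 0 x = x) ∧ ∀ x t, HasDerivAt (fun s => φ s x) (X (φ t x)) t

/-- `Φ` is a smooth diffeomorphism of phase space. -/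
def IsDiffeo {d : ℕ} (Φ : Phase d → Phase d) : Prop :=
  ContDiff ℝ (⊤ : ℕ∞) Φ ∧
    ∃ Ψ, ContDiff ℝ (⊤ : ℕ∞) Ψ ∧ Function.LeftInverse Ψ Φ ∧ Function.RightInverse Ψ Φ

/-- `Φ` is a Hamiltonian diffeomorphism of `T*ℝ^d`: a smooth diffeomorphism which is the
time-1 flow map of a smooth time-dependent Hamiltonian whose non-autonomous Hamiltonian flow
is defined on `[0,1]` from every initial point. -/
def IsHamDiffeo {d : ℕ} (Φ : Phase d → Phase d) : Prop :=
  IsDiffeo Φ ∧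
  ∃ (H : ℝ → Phase d → ℝ) (φ : ℝ → Phase d → Phase d),
    ContDiff ℝ (⊤ : ℕ∞) (fun z : ℝ × Phase d => H z.1 z.2) ∧
    (∀ x, φ 0 x = x) ∧
    (∀ x, ∀ t ∈ Set.Icc (0:ℝ) 1,
      HasDerivWithinAt (fun s => φ s x) (hamVF (H t) (φ t x)) (Set.Icc (0:ℝ) 1) t) ∧
    Φ = φ 1

/-- `Φ` is the flow map from time `0` to time `τ` of the time-dependent Hamiltonian vector
field `H⃗_{u(t)}` for some piecewise constant control `u(·) : [0,τ] → U` (finitely many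
pieces): i.e. `Φ` is a finite composition of flows of the autonomous fields `H⃗_{u_i}`
for nonnegative durations summing to `τ`. -/
def Reachable {d : ℕ} {U : Type*} (Ham : U → Phase d → ℝ) (τ : ℝ)
    (Φ : Phase d → Phase d) : Prop :=
  ∃ (n : ℕ) (dur : Fin n → ℝ) (u : Fin n → U) (φ : Fin n → ℝ → Phase d → Phase d),
    (∀ i, 0 ≤ dur i) ∧ (∑ i, dur i) = τ ∧
    (∀ i, IsFlowOf (hamVF (Ham (u i))) (φ i)) ∧
    Φ = (List.ofFn (fun i => φ i (dur i))).foldl (fun g f => f ∘ g) id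

/-- `‖Φ − Ψ‖_{C^ℓ(K)} < ε`: all iterated derivatives of the difference up to order `ℓ`
are smaller than `ε` on `K`. -/
def CloseCl {d : ℕ} (ℓ : ℕ) (K : Set (Phase d)) (ε : ℝ) (Φ Ψ : Phase d → Phase d) : Prop :=
  ∀ j ≤ ℓ, ∀ x ∈ K, ‖iteratedFDeriv ℝ j (fun y => Φ y - Ψ y) x‖ < ε

/-- `Ψ ∈ R̄_st`: the diffeomorphism `Ψ` is small-time approximately reachable for the
control system with controlled Hamiltonians `Ham u`, `u ∈ U`. -/
def SmallTimeReachable {d : ℕ} {U : Type*} (Ham : U → Phase d → ℝ)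
    (Ψ : Phase d → Phase d) : Prop :=
  ∀ ε > 0, ∀ K : Set (Phase d), IsCompact K → ∀ ℓ : ℕ,
    ∃ τ ∈ Set.Icc (0:ℝ) ε, ∃ Φ, Reachable Ham τ Φ ∧ CloseCl ℓ K ε Φ Ψ

/-- A function `f` with complete Hamiltonian vector field is STAR (small-time approximately
reachable) if its flow at every time `s ∈ ℝ` belongs to `R̄_st`. -/
def IsSTAR {d : ℕ} {U : Type*} (Ham : U → Phase d → ℝ) (f : Phase d → ℝ) : Prop :=
  (∃ φ, IsFlowOf (hamVF f) φ) ∧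
  ∀ φ, IsFlowOf (hamVF f) φ → ∀ s : ℝ, SmallTimeReachable Ham (φ s)

/-- The Poisson bracket `{f,g} = Σ_j (∂_{p_j} f ∂_{q_j} g − ∂_{q_j} f ∂_{p_j} g)`. -/
def poissonBracket {d : ℕ} (f g : Phase d → ℝ) : Phase d → ℝ :=
  fun x => ∑ j, (fderiv ℝ f x (0, Pi.single j 1) * fderiv ℝ g x (Pi.single j 1, 0)
      - fderiv ℝ f x (Pi.single j 1, 0) * fderiv ℝ g x (0, Pi.single j 1))

/-- The mechanical Hamiltonian `H_u(q,p) = |p|²/2 + V_0(q) + Σ_j u_j V_j(q)`. -/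
def mechHam {d m : ℕ} (V0 : (Fin d → ℝ) → ℝ) (V : Fin m → (Fin d → ℝ) → ℝ)
    (u : Fin m → ℝ) : Phase d → ℝ :=
  fun x => (∑ i, (x.2 i) ^ 2) / 2 + V0 x.1 + ∑ j, u j * V j x.1

/-- The Euclidean controlled Hamiltonian
`H_u(q,p) = |p|²/2 + V_0(q) + Σ_{j=1}^d u_j q_j + u_{d+1} e^{−|q|²/2}`,
with control `u ∈ ℝ^d × ℝ ≃ ℝ^{d+1}`. -/
def eucHam {d : ℕ} (V0 : (Fin d → ℝ) → ℝ) (u : (Fin d → ℝ) × ℝ) : Phase d → ℝ :=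
  fun x => (∑ i, (x.2 i) ^ 2) / 2 + V0 x.1 + (∑ j, u.1 j * x.1 j)
    + u.2 * Real.exp (-(∑ i, (x.1 i) ^ 2) / 2)

/-- The frequencies `k_1 = e_1, …, k_{d−1} = e_{d−1}, k_d = (1,…,1)`. -/
def kvec (d : ℕ) (j : Fin d) : Fin d → ℝ :=
  if (j : ℕ) < d - 1 then Pi.single j 1 else fun _ => 1

/-- The torus controlled Hamiltonian (lifted to `ℝ^d × ℝ^d`)
`H_u(q,p) = |p|²/2 + V_0(q) + Σ_{j=1}^d (u_{2j−1} cos(k_j·q) + u_{2j} sin(k_j·q))`,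
with control `u ∈ (ℝ²)^d ≃ ℝ^{2d}`. -/
def torusHam {d : ℕ} (V0 : (Fin d → ℝ) → ℝ) (u : Fin d → ℝ × ℝ) : Phase d → ℝ :=
  fun x => (∑ i, (x.2 i) ^ 2) / 2 + V0 x.1 +
    ∑ j, ((u j).1 * Real.cos (∑ i, kvec d j i * x.1 i) +
          (u j).2 * Real.sin (∑ i, kvec d j i * x.1 i))

/-- The vertical shear `(q,p) ↦ (q, p − ∇f(q))`. -/
def vshear {d : ℕ} (f : (Fin d → ℝ) → ℝ) : Phase d → Phase d :=
  fun x => (x.1, fun i => x.2 i - fderiv ℝ f x.1 (Pi.single i 1))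

/-- The horizontal shear `(q,p) ↦ (q + ∇g(p), p)`. -/
def hshear {d : ℕ} (g : (Fin d → ℝ) → ℝ) : Phase d → Phase d :=
  fun x => (fun i => x.1 i + fderiv ℝ g x.2 (Pi.single i 1), x.2)

/-- `M` is a mesh of size `h`: the closed sup-norm cubes `C̄(m_n,h)` cover `ℝ^{2d}` and the
open cubes `C(m_n,h)` are pairwise disjoint. -/
def IsMesh {d : ℕ} (h : ℝ) (M : ℕ → Phase d) : Prop :=
  (∀ x : Phase d, ∃ n, ‖x - M n‖ ≤ h) ∧
  ∀ n ℓ : ℕ, n ≠ ℓ →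
    Disjoint {x : Phase d | ‖x - M n‖ < h} {x : Phase d | ‖x - M ℓ‖ < h}

/-- `F` is a permutation of the mesh `M` of size `h`: a bijection translating every open
cube of the mesh onto another one. -/
def IsMeshPermutation {d : ℕ} (h : ℝ) (M : ℕ → Phase d) (F : Phase d → Phase d) : Prop :=
  Function.Bijective F ∧
  ∀ n : ℕ, ∃ ℓ : ℕ, ∀ x : Phase d, ‖x - M n‖ < h → F x = x + (M ℓ - M n)

/-- The fundamental domain `Q = [0,2π)^d × ℝ^d` of `T*𝕋^d` in `ℝ^d × ℝ^d`. -/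
def torusBlock (d : ℕ) : Set (Phase d) :=
  {x : Phase d | ∀ i, 0 ≤ x.1 i ∧ x.1 i < 2 * Real.pi}

/-- A torus density of class `L^r`: a measurable function on `ℝ^d × ℝ^d`, `2π`-periodic in
each position variable, with finite `L^r` norm on the fundamental domain `Q`. -/
def IsTorusDensity {d : ℕ} (p : ENNReal) (ρ : Phase d → ℝ) : Prop :=
  Measurable ρ ∧
  (∀ (q : Fin d → ℝ) (pp : Fin d → ℝ) (k : Fin d → ℤ),
    ρ (fun i => q i + 2 * Real.pi * (k i), pp) = ρ (q, pp)) ∧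
  eLpNorm ρ p (volume.restrict (torusBlock d)) < ⊤

end

section ODE
open Set Filter Topology ContDiff Manifold NNReal

/-- Global existence for globally Lipschitz, `C^1` vector fields. -/
theorem aux_global_flow {E : Type*} [NormedAddCommGroup E] [NormedSpace ℝ E] [CompleteSpace E]
    (X : E → E) (hX : ContDiff ℝ 1 X) (K : ℝ≥0) (hK : LipschitzWith K X) (x : E) :
    ∃ γ : ℝ → E, γ 0 = x ∧ ∀ t, HasDerivAt γ (X (γ t)) t := by
  set ε : ℝ := 1 / (2 * ((K : ℝ) + 1)) with hεdef
  have hε : 0 < ε := by positivity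
  have key : ∀ x : E, ∃ γ : ℝ → E, γ 0 = x ∧
      ∀ t ∈ Ioo (-ε) ε, HasDerivAt γ (X (γ t)) t := by
    intro x
    have hmem : (0 : ℝ) ∈ Icc (-ε) ε := ⟨by linarith, hε.le⟩
    have hpl : IsPicardLindelof (fun _ => X) (⟨0, hmem⟩ : Icc (-ε) ε) x (‖X x‖₊ + 1) 0
        (‖X x‖₊ + K * (‖X x‖₊ + 1)) K := by
      apply IsPicardLindelof.of_time_independent
      · intro y hy
        have h1 : ‖X y - X x‖ ≤ K * ‖y - x‖ := hK.norm_sub_le y x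
        have h2 : ‖y - x‖ ≤ ‖X x‖ + 1 := by
          have := mem_closedBall_iff_norm.1 hy
          simpa using this
        have h3 : ‖X y‖ ≤ ‖X x‖ + ‖X y - X x‖ := by
          have := norm_add_le (X x) (X y - X x)
          simpa using this
        push_cast
        have : (K : ℝ) * ‖y - x‖ ≤ K * (‖X x‖ + 1) := by gcongr
        linarith
      · exact hK.lipschitzOnWith
      · simp only [sub_zero, zero_sub, neg_neg, max_self]
        push_cast
        simp only [sub_zero]
        rw [hεdef, mul_one_div, div_le_iff₀ (by positivity)]
        nlinarith [norm_nonneg (X x), K.2, mul_nonneg K.2 (norm_nonneg (X x))]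
    obtain ⟨α, hα1, hα2⟩ := hpl.exists_eq_forall_mem_Icc_hasDerivWithinAt₀
    refine ⟨α, hα1, fun t ht => ?_⟩
    exact (hα2 t (Ioo_subset_Icc_self ht)).hasDerivAt (Icc_mem_nhds ht.1 ht.2)
  obtain ⟨γ, h0, hγ⟩ := exists_isMIntegralCurve_of_isMIntegralCurveOn (I := 𝓘(ℝ, E)) (M := E)
    (v := X) (contMDiff_vectorSpace_iff_contDiff.2 hX) hε (fun x => by
      obtain ⟨γ, h0, hγ⟩ := key x
      refine ⟨γ, h0, fun t ht => ?_⟩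
      exact (hasMFDerivAt_iff_hasFDerivAt.2 (hγ t ht).hasFDerivAt).hasMFDerivWithinAt) x
  refine ⟨γ, h0, fun t => ?_⟩
  have h1 : HasFDerivAt γ (ContinuousLinearMap.smulRight (1 : ℝ →L[ℝ] ℝ) (X (γ t)) : ℝ →L[ℝ] E) t :=
    hasMFDerivAt_iff_hasFDerivAt.1 (hγ t)
  have h2 := h1.hasDerivAt
  simpa using h2

abbrev UI := Set.Icc (0 : ℝ) 1

/-- pointwise application of continuous families of linear maps -/
noncomputable def pwApply {G E F : Type} [NormedAddCommGroup E] [NormedSpace ℝ E]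
    [NormedAddCommGroup F] [NormedSpace ℝ F] [NormedAddCommGroup G] [NormedSpace ℝ G]
    (B : G →L[ℝ] E →L[ℝ] F) :
    C(UI, G) →L[ℝ] (C(UI, E) →L[ℝ] C(UI, F)) :=
  LinearMap.mkContinuous₂
    (LinearMap.mk₂ ℝ (fun (L : C(UI, G)) (h : C(UI, E)) =>
      (⟨fun t => B (L t) (h t), (B.continuous.comp L.continuous).clm_apply h.continuous⟩ : C(UI, F)))
      (by intros; ext; simp) (by intros; ext; simp) (by intros; ext; simp) (by intros; ext; simp))
    ‖B‖ (by
      intro L h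
      rw [ContinuousMap.norm_le _ (by positivity)]
      intro t
      simp only [LinearMap.mk₂_apply, ContinuousMap.coe_mk]
      calc ‖B (L t) (h t)‖ ≤ ‖B‖ * ‖L t‖ * ‖h t‖ := B.le_opNorm₂ _ _
        _ ≤ ‖B‖ * ‖L‖ * ‖h‖ := by gcongr <;> exact ContinuousMap.norm_coe_le_norm _ _)

@[simp] theorem pwApply_apply {G E F : Type} [NormedAddCommGroup E] [NormedSpace ℝ E]
    [NormedAddCommGroup F] [NormedSpace ℝ F] [NormedAddCommGroup G] [NormedSpace ℝ G]
    (B : G →L[ℝ] E →L[ℝ] F) (L : C(UI, G)) (h : C(UI, E)) (t : UI) :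
    pwApply B L h t = B (L t) (h t) := rfl

theorem supop_hasFDerivAt {G E F : Type} [NormedAddCommGroup E] [NormedSpace ℝ E]
    [NormedAddCommGroup F] [NormedSpace ℝ F] [NormedAddCommGroup G] [NormedSpace ℝ G]
    (B : G →L[ℝ] E →L[ℝ] F) (hB : ∀ g, ‖B g‖ ≤ ‖g‖) (X : C(E, F)) (X' : C(E, G))
    (h : ∀ x, HasFDerivAt X (B (X' x)) x) (γ : C(UI, E)) :
    HasFDerivAt (fun γ : C(UI, E) => X.comp γ) (pwApply B (X'.comp γ)) γ := by
  rw [hasFDerivAt_iff_isLittleO_nhds_zero, Asymptotics.isLittleO_iff]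
  intro c hc
  have hcont : Continuous (fun γ : C(UI, E) => X'.comp γ) := ContinuousMap.continuous_postcomp X'
  obtain ⟨δ, hδ, hδ'⟩ := (Metric.continuousAt_iff (f := fun γ : C(UI, E) => X'.comp γ) (a := γ)).1
    hcont.continuousAt c hc
  filter_upwards [Metric.ball_mem_nhds (0 : C(UI, E)) hδ] with k hk
  rw [ContinuousMap.norm_le _ (by positivity)]
  intro t
  have hkt : ‖k t‖ ≤ ‖k‖ := ContinuousMap.norm_coe_le_norm _ _
  have hk' : ‖k‖ < δ := by simpa using hk
  have hb : ∀ y ∈ Metric.ball (γ t) δ, ‖B (X' y) - B (X' (γ t))‖ ≤ c := by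
    intro y hy
    have h1 : dist (γ + ContinuousMap.const UI (y - γ t)) γ < δ := by
      rw [dist_eq_norm, add_sub_cancel_left]
      refine lt_of_le_of_lt (b := ‖y - γ t‖) ?_ (mem_ball_iff_norm.1 hy)
      rw [ContinuousMap.norm_le _ (by positivity)]
      intro s; simp
    have h2 := hδ' h1
    rw [dist_eq_norm] at h2
    have h3 := ContinuousMap.norm_coe_le_norm
      (X'.comp (γ + ContinuousMap.const UI (y - γ t)) - X'.comp γ) t
    simp at h3
    rw [← map_sub]
    exact (hB _).trans (h3.trans h2.le)
  have := (convex_ball (γ t) δ).norm_image_sub_le_of_norm_hasFDerivWithin_le'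
    (f := X) (f' := fun y => B (X' y)) (φ := B (X' (γ t))) (x := γ t) (y := γ t + k t) (C := c)
    (fun y _ => (h y).hasFDerivWithinAt) hb (Metric.mem_ball_self hδ)
    (by simpa using lt_of_le_of_lt hkt hk')
  simp only [add_sub_cancel_left] at this
  simp only [ContinuousMap.sub_apply, ContinuousMap.comp_apply, ContinuousMap.add_apply,
    pwApply_apply]
  exact this.trans (by gcongr)

theorem supop_step {G E F : Type} [NormedAddCommGroup E] [NormedSpace ℝ E]
    [NormedAddCommGroup F] [NormedSpace ℝ F] [NormedAddCommGroup G] [NormedSpace ℝ G]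
    (B : G →L[ℝ] E →L[ℝ] F) (hB : ∀ g, ‖B g‖ ≤ ‖g‖) (X : C(E, F)) (X' : C(E, G))
    (h : ∀ x, HasFDerivAt X (B (X' x)) x) (n : ℕ)
    (hn : ContDiff ℝ n (fun γ : C(UI, E) => X'.comp γ)) :
    ContDiff ℝ (n + 1 : ℕ) (fun γ : C(UI, E) => X.comp γ) := by
  have hd := supop_hasFDerivAt B hB X X' h
  rw [Nat.cast_succ, contDiff_succ_iff_fderiv]
  refine ⟨fun γ => (hd γ).differentiableAt, by simp, ?_⟩
  rw [show (fderiv ℝ fun γ : C(UI, E) => X.comp γ) = _ from funext fun γ => (hd γ).fderiv]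
  have hc : ContDiff ℝ n (fun L : C(UI, G) => pwApply B L) :=
    by fun_prop
  exact hc.comp hn

theorem supop_contDiff_nat (n : ℕ) : ∀ {E F : Type} [NormedAddCommGroup E] [NormedSpace ℝ E]
    [NormedAddCommGroup F] [NormedSpace ℝ F] (X : C(E, F)) (_ : ContDiff ℝ ∞ X),
    ContDiff ℝ n (fun γ : C(UI, E) => X.comp γ) := by
  induction n with
  | zero =>
    intro E F _ _ _ _ X hX
    exact contDiff_zero.2 (ContinuousMap.continuous_postcomp X)
  | succ n ih =>
    intro E F _ _ _ _ X hX
    have hX' : ContDiff ℝ ∞ (fderiv ℝ X) := hX.fderiv_right (by simp)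
    exact supop_step (ContinuousLinearMap.id ℝ (E →L[ℝ] F)) (fun g => le_rfl) X
      ⟨fderiv ℝ X, hX'.continuous⟩
      (fun x => (hX.differentiable (by simp) x).hasFDerivAt) n
      (ih (⟨fderiv ℝ X, hX'.continuous⟩ : C(E, E →L[ℝ] F)) hX')

theorem supop_contDiff {E F : Type} [NormedAddCommGroup E] [NormedSpace ℝ E]
    [NormedAddCommGroup F] [NormedSpace ℝ F] (X : C(E, F)) (hX : ContDiff ℝ ∞ X) :
    ContDiff ℝ ∞ (fun γ : C(UI, E) => X.comp γ) :=
  contDiff_infty.2 fun n => supop_contDiff_nat n X hX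

theorem cont_projUI {E : Type} [NormedAddCommGroup E] (γ : C(UI, E)) :
    Continuous (fun s : ℝ => γ (projIcc 0 1 zero_le_one s)) :=
  γ.continuous.comp continuous_projIcc

/-- Volterra integration operator. -/
noncomputable def volterra (E : Type) [NormedAddCommGroup E] [NormedSpace ℝ E] :
    C(UI, E) →L[ℝ] C(UI, E) :=
  LinearMap.mkContinuous
    { toFun := fun γ => (⟨fun t => ∫ s in (0:ℝ)..t, γ (projIcc 0 1 zero_le_one s),
        (intervalIntegral.continuous_primitive
          (fun a b => (cont_projUI γ).intervalIntegrable a b) 0).comp continuous_subtype_val⟩ :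
          C(UI, E))
      map_add' := by
        intro γ γ'
        ext t
        simp only [ContinuousMap.coe_mk, ContinuousMap.add_apply]
        exact intervalIntegral.integral_add ((cont_projUI γ).intervalIntegrable _ _)
          ((cont_projUI γ').intervalIntegrable _ _)
      map_smul' := by
        intro c γ
        ext t
        simp [intervalIntegral.integral_smul] }
    1 (by
      intro γ
      rw [ContinuousMap.norm_le _ (by positivity)]
      intro t
      simp only [LinearMap.coe_mk, AddHom.coe_mk, ContinuousMap.coe_mk, one_mul]
      have := intervalIntegral.norm_integral_le_of_norm_le_const (a := (0:ℝ)) (b := t) (C := ‖γ‖)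
        (f := fun s => γ (projIcc 0 1 zero_le_one s))
        (fun s _ => ContinuousMap.norm_coe_le_norm _ _)
      refine this.trans ?_
      rw [sub_zero, abs_of_nonneg t.2.1]
      nlinarith [t.2.2, norm_nonneg γ])

theorem volterra_apply {E : Type} [NormedAddCommGroup E] [NormedSpace ℝ E] (γ : C(UI, E))
    (t : UI) : volterra E γ t = ∫ s in (0:ℝ)..t, γ (projIcc 0 1 zero_le_one s) := rfl

theorem volterra_norm_le {E : Type} [NormedAddCommGroup E] [NormedSpace ℝ E] (γ : C(UI, E)) :
    ‖volterra E γ‖ ≤ ‖γ‖ := by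
  have := (volterra E).le_of_opNorm_le (c := 1) (LinearMap.mkContinuous_norm_le _ zero_le_one _) γ
  simpa using this

theorem ode_smooth {E : Type} [NormedAddCommGroup E] [NormedSpace ℝ E] [CompleteSpace E]
    (A B : E → E) (hA : ContDiff ℝ ∞ A) (hB : ContDiff ℝ ∞ B) (K : ℝ≥0)
    (LA : LipschitzWith K A) (LB : LipschitzWith (1/4) B) :
    ∃ η > (0:ℝ), ∃ Ψ : ℝ × E → E, ContDiffOn ℝ ∞ Ψ (Ioo (-η) η ×ˢ univ) ∧
      ∀ τ ∈ Ioo (-η) η, ∀ γ : ℝ → E, (∀ t, HasDerivAt γ (τ • A (γ t) + B (γ t)) t) →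
        γ 1 = Ψ (τ, γ 0) := by
  set η : ℝ := 1 / (4 * ((K:ℝ) + 1)) with hη
  have hηpos : 0 < η := by positivity
  let cA : C(E, E) := ⟨A, hA.continuous⟩
  let cB : C(E, E) := ⟨B, hB.continuous⟩
  let T : ℝ → C(UI, E) → C(UI, E) := fun τ γ => volterra E (τ • cA.comp γ + cB.comp γ)
  let G : (ℝ × E) × C(UI, E) → C(UI, E) := fun z =>
    z.2 - ContinuousMap.const UI z.1.2 - T z.1.1 z.2
  have hT : ∀ τ ∈ Ioo (-η) η, LipschitzWith (1/2) (T τ) := by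
    intro τ hτ
    apply LipschitzWith.of_dist_le_mul
    intro γ γ'
    rw [dist_eq_norm, dist_eq_norm, ← map_sub]
    refine (volterra_norm_le _).trans ?_
    rw [ContinuousMap.norm_le _ (by positivity)]
    intro t
    have h0 : ‖γ t - γ' t‖ ≤ ‖γ - γ'‖ := ContinuousMap.norm_coe_le_norm (γ - γ') t
    have h1 := LA.norm_sub_le (γ t) (γ' t)
    have h2 := LB.norm_sub_le (γ t) (γ' t)
    have hτ' : |τ| ≤ η := abs_le.2 ⟨hτ.1.le, hτ.2.le⟩
    have e : (τ • cA.comp γ + cB.comp γ - (τ • cA.comp γ' + cB.comp γ')) t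
        = τ • (A (γ t) - A (γ' t)) + (B (γ t) - B (γ' t)) := by
      simp [cA, cB, smul_sub]; abel
    rw [e]
    refine (norm_add_le _ _).trans ?_
    rw [norm_smul, Real.norm_eq_abs]
    have h3 : |τ| * ‖A (γ t) - A (γ' t)‖ ≤ η * (K * ‖γ t - γ' t‖) := by gcongr
    have h4 : η * K ≤ 1/4 := by
      rw [hη, one_div_mul_eq_div, div_le_iff₀ (by positivity)]; nlinarith [K.2]
    have h5 : η * (K * ‖γ t - γ' t‖) ≤ 1/4 * ‖γ t - γ' t‖ := by
      rw [← mul_assoc]; gcongr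
    push_cast at h2 ⊢
    linarith
  have hGs : ContDiff ℝ ∞ G := by
    have e1 : ContDiff ℝ ∞ (fun z : (ℝ × E) × C(UI, E) => cA.comp z.2) :=
      (supop_contDiff cA hA).comp contDiff_snd
    have e2 : ContDiff ℝ ∞ (fun z : (ℝ × E) × C(UI, E) => cB.comp z.2) :=
      (supop_contDiff cB hB).comp contDiff_snd
    have e3 : ContDiff ℝ ∞ (fun z : (ℝ × E) × C(UI, E) => T z.1.1 z.2) := by
      apply (volterra E).contDiff.comp
      exact ((contDiff_fst.comp contDiff_fst).smul e1).add e2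
    have e4 : ContDiff ℝ ∞ (fun x : E => ContinuousMap.const UI x) := by
      have : IsBoundedLinearMap ℝ (fun x : E => ContinuousMap.const UI x) :=
        { map_add := fun x y => by ext; simp
          map_smul := fun c x => by ext; simp
          bound := ⟨1, one_pos, fun x => by
            rw [ContinuousMap.norm_le _ (by positivity)]; intro t; simp⟩ }
      exact this.contDiff
    exact (contDiff_snd.sub (e4.comp (contDiff_snd.comp contDiff_fst))).sub e3
  have huniq : ∀ τ ∈ Ioo (-η) η, ∀ x γ γ', G ((τ, x), γ) = 0 → G ((τ, x), γ') = 0 → γ = γ' := by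
    intro τ hτ x γ γ' h h'
    have h1 := (hT τ hτ).norm_sub_le γ γ'
    have h2 : T τ γ - T τ γ' = γ - γ' := by
      simp only [G] at h h'
      have a1 := sub_eq_zero.1 h
      have a2 := sub_eq_zero.1 h'
      rw [← a1, ← a2]; abel
    rw [h2] at h1
    push_cast at h1
    have : ‖γ - γ'‖ ≤ 0 := by linarith [norm_nonneg (γ - γ')]
    exact sub_eq_zero.1 (norm_le_zero_iff.1 this)
  have hcurve : ∀ τ : ℝ, ∀ γ : ℝ → E, (∀ t, HasDerivAt γ (τ • A (γ t) + B (γ t)) t) →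
      ∃ c : C(UI, E), G ((τ, γ 0), c) = 0 ∧ ∀ t : UI, c t = γ t := by
    intro τ γ hγ
    have hc : Continuous γ := continuous_iff_continuousAt.2 fun t => (hγ t).continuousAt
    refine ⟨⟨fun t => γ t, hc.comp continuous_subtype_val⟩, ?_, fun t => rfl⟩
    ext t
    simp only [G, T, ContinuousMap.sub_apply, volterra_apply, ContinuousMap.coe_mk,
      ContinuousMap.const_apply, ContinuousMap.zero_apply]
    have : ∫ s in (0:ℝ)..t, (τ • A (γ s) + B (γ s)) = γ t - γ 0 := by
      apply intervalIntegral.integral_eq_sub_of_hasDerivAt (fun s _ => hγ s)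
      apply Continuous.intervalIntegrable
      exact ((hA.continuous.comp hc).const_smul τ).add (hB.continuous.comp hc)
    rw [sub_eq_zero, ← this]
    apply intervalIntegral.integral_congr
    intro s hs
    rw [uIcc_of_le t.2.1] at hs
    have hs' : s ∈ Icc (0:ℝ) 1 := ⟨hs.1, hs.2.trans t.2.2⟩
    simp [projIcc_of_mem zero_le_one hs', cA, cB]
  have hex : ∀ τ : ℝ, ∀ x, ∃ c : C(UI, E), G ((τ, x), c) = 0 := by
    intro τ x
    obtain ⟨γ, h0, hγ⟩ := aux_global_flow (fun x => τ • A x + B x)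
      (((hA.const_smul τ).add hB).of_le (by simp))
      (‖τ‖₊ * K + 1/4) ((lipschitzWith_smul τ).comp LA |>.add LB) x
    obtain ⟨c, hc, -⟩ := hcurve τ γ hγ
    exact ⟨c, by rw [← h0]; exact hc⟩
  choose sol hsol using hex
  refine ⟨η, hηpos, fun z => sol z.1 z.2 ⟨1, by simp⟩, ?_, ?_⟩
  · have hopen : IsOpen (Ioo (-η) η ×ˢ (univ : Set E)) := isOpen_Ioo.prod isOpen_univ
    intro z hz
    apply ContDiffAt.contDiffWithinAt
    have hz1 : z.1 ∈ Ioo (-η) η := hz.1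
    set u : (ℝ × E) × C(UI, E) := (z, sol z.1 z.2) with hu
    have hinv : (fderiv ℝ G u ∘L .inr ℝ (ℝ × E) C(UI, E)).IsInvertible := by
      have hd1 : HasFDerivAt (fun c : C(UI, E) => G (z, c))
          (fderiv ℝ G u ∘L .inr ℝ (ℝ × E) C(UI, E)) u.2 := by
        have := (hGs.differentiable (by simp) u).hasFDerivAt
        exact this.comp u.2 (hasFDerivAt_prodMk_right z u.2)
      have hd2 : HasFDerivAt (T z.1) (ContinuousLinearMap.id ℝ _ -
          fderiv ℝ G u ∘L .inr ℝ (ℝ × E) C(UI, E)) u.2 := by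
        have := ((hasFDerivAt_id u.2).sub_const (ContinuousMap.const UI z.2)).sub hd1
        refine this.congr_of_eventuallyEq (Eventually.of_forall fun c => ?_)
        simp [G]
      have hn := hd2.le_of_lipschitz (hT z.1 hz1)
      have hunit := isUnit_one_sub_of_norm_lt_one (lt_of_le_of_lt hn (by push_cast; norm_num))
      have e : (1 - (ContinuousLinearMap.id ℝ _ - fderiv ℝ G u ∘L .inr ℝ (ℝ × E) C(UI, E))) =
          fderiv ℝ G u ∘L .inr ℝ (ℝ × E) C(UI, E) := by
        ext; simp
      rw [e] at hunit
      obtain ⟨w, hw⟩ := hunit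
      exact ⟨ContinuousLinearEquiv.unitsEquiv ℝ _ w, by rw [← hw]; rfl⟩
    have hcd : ContDiffAt ℝ ∞ G u := hGs.contDiffAt
    have h1 := hcd.contDiffAt_implicitFunction (by simp) hinv
    have h2 := hcd.eventually_apply_implicitFunction (by simp) hinv
    have h3 : ∀ᶠ y in 𝓝 u.1, sol y.1 y.2 = hcd.implicitFunction (by simp) hinv y := by
      filter_upwards [h2, hopen.mem_nhds hz] with y hy hy'
      refine huniq y.1 hy'.1 y.2 _ _ (hsol _ _) ?_
      have hu0 : G u = 0 := hsol _ _
      exact hy.trans hu0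
    have h4 : ContDiffAt ℝ ∞ (fun z : ℝ × E => sol z.1 z.2) z := h1.congr_of_eventuallyEq h3
    exact (ContinuousMap.evalCLM ℝ (⟨1, by simp⟩ : UI)).contDiff.contDiffAt.comp z h4
  · intro τ hτ γ hγ
    obtain ⟨c, hc, hc'⟩ := hcurve τ γ hγ
    have := huniq τ hτ _ _ _ hc (hsol τ (γ 0))
    simp only
    rw [← this, hc']

end ODE


section CCsec
open Set Filter Topology ContDiff

/-- `C^n` convergence, uniformly near every point (continuous convergence of derivatives). -/
def CC {E : Type} [NormedAddCommGroup E] [NormedSpace ℝ E] : (n : ℕ) → {G : Type} →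
    [NormedAddCommGroup G] → [NormedSpace ℝ G] → (ℕ → E → G) → (E → G) → Prop
  | 0, _, _, _, F, f => ∀ x, Tendsto (fun z : ℕ × E => F z.1 z.2) (atTop ×ˢ 𝓝 x) (𝓝 (f x))
  | n + 1, _, _, _, F, f =>
    (∀ x, Tendsto (fun z : ℕ × E => F z.1 z.2) (atTop ×ˢ 𝓝 x) (𝓝 (f x))) ∧
      CC n (fun k => fderiv ℝ (F k)) (fderiv ℝ f)

variable {E : Type} [NormedAddCommGroup E] [NormedSpace ℝ E]

theorem CC.zero' {G : Type} [NormedAddCommGroup G] [NormedSpace ℝ G] {n : ℕ}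
    {F : ℕ → E → G} {f : E → G} (h : CC n F f) : CC 0 F f := by
  cases n with
  | zero => exact h
  | succ n => exact h.1

theorem CC.pred (n : ℕ) : ∀ {G : Type} [NormedAddCommGroup G] [NormedSpace ℝ G]
    {F : ℕ → E → G} {f : E → G} (_ : CC (n + 1) F f), CC n F f := by
  induction n with
  | zero => intro G _ _ F f h; exact h.1
  | succ n ih => intro G _ _ F f h; exact ⟨h.1, ih h.2⟩

theorem CC.const (n : ℕ) : ∀ {G : Type} [NormedAddCommGroup G] [NormedSpace ℝ G]
    {f : E → G} (_ : ContDiff ℝ ∞ f), CC n (fun _ => f) f := by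
  induction n with
  | zero =>
    intro G _ _ f h x
    exact (h.continuous.tendsto x).comp tendsto_snd
  | succ n ih =>
    intro G _ _ f h
    exact ⟨fun x => (h.continuous.tendsto x).comp tendsto_snd, ih (h.fderiv_right (by simp))⟩

theorem CC.add (n : ℕ) : ∀ {G : Type} [NormedAddCommGroup G] [NormedSpace ℝ G]
    {F H : ℕ → E → G} {f h : E → G} (_ : ∀ k, ContDiff ℝ ∞ (F k)) (_ : ∀ k, ContDiff ℝ ∞ (H k))
    (_ : ContDiff ℝ ∞ f) (_ : ContDiff ℝ ∞ h) (_ : CC n F f) (_ : CC n H h),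
    CC n (fun k x => F k x + H k x) (fun x => f x + h x) := by
  induction n with
  | zero =>
    intro G _ _ F H f h hF hH hf hh h1 h2 x
    exact (h1 x).add (h2 x)
  | succ n ih =>
    intro G _ _ F H f h hF hH hf hh h1 h2
    refine ⟨fun x => (h1.1 x).add (h2.1 x), ?_⟩
    have e1 : (fun k => fderiv ℝ (fun x => F k x + H k x)) =
        fun k x => fderiv ℝ (F k) x + fderiv ℝ (H k) x := by
      funext k x
      exact fderiv_fun_add ((hF k).differentiable (by simp) x) ((hH k).differentiable (by simp) x)
    have e2 : (fderiv ℝ (fun x => f x + h x)) = fun x => fderiv ℝ f x + fderiv ℝ h x := by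
      funext x
      exact fderiv_fun_add (hf.differentiable (by simp) x) (hh.differentiable (by simp) x)
    rw [e1, e2]
    exact ih (fun k => (hF k).fderiv_right (by simp)) (fun k => (hH k).fderiv_right (by simp))
      (hf.fderiv_right (by simp)) (hh.fderiv_right (by simp)) h1.2 h2.2

theorem CC.bilin (n : ℕ) : ∀ {G G' G'' : Type} [NormedAddCommGroup G] [NormedSpace ℝ G]
    [NormedAddCommGroup G'] [NormedSpace ℝ G'] [NormedAddCommGroup G''] [NormedSpace ℝ G'']
    (B : G →L[ℝ] G' →L[ℝ] G'')
    {F : ℕ → E → G} {H : ℕ → E → G'} {f : E → G} {h : E → G'}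
    (_ : ∀ k, ContDiff ℝ ∞ (F k)) (_ : ∀ k, ContDiff ℝ ∞ (H k))
    (_ : ContDiff ℝ ∞ f) (_ : ContDiff ℝ ∞ h) (_ : CC n F f) (_ : CC n H h),
    CC n (fun k x => B (F k x) (H k x)) (fun x => B (f x) (h x)) := by
  have base : ∀ {G G' G'' : Type} [NormedAddCommGroup G] [NormedSpace ℝ G]
    [NormedAddCommGroup G'] [NormedSpace ℝ G'] [NormedAddCommGroup G''] [NormedSpace ℝ G'']
    (B : G →L[ℝ] G' →L[ℝ] G'')
    {F : ℕ → E → G} {H : ℕ → E → G'} {f : E → G} {h : E → G'} (_ : CC 0 F f) (_ : CC 0 H h),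
      CC 0 (fun k x => B (F k x) (H k x)) (fun x => B (f x) (h x)) := by
    intro G G' G'' _ _ _ _ _ _ B F H f h h1 h2 x
    have := (B.continuous₂.tendsto (f x, h x)).comp ((h1 x).prodMk_nhds (h2 x))
    exact this
  induction n with
  | zero =>
    intro G G' G'' _ _ _ _ _ _ B F H f h _ _ _ _ h1 h2
    exact base B h1 h2
  | succ n ih =>
    intro G G' G'' _ _ _ _ _ _ B F H f h hF hH hf hh h1 h2
    refine ⟨base B h1.zero' h2.zero', ?_⟩
    have e1 : (fun k => fderiv ℝ (fun x => B (F k x) (H k x))) =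
        fun k x => B.precompR E (F k x) (fderiv ℝ (H k) x)
          + B.precompL E (fderiv ℝ (F k) x) (H k x) := by
      funext k x
      exact B.fderiv_of_bilinear ((hF k).differentiable (by simp) x)
        ((hH k).differentiable (by simp) x)
    have e2 : fderiv ℝ (fun x => B (f x) (h x)) =
        fun x => B.precompR E (f x) (fderiv ℝ h x) + B.precompL E (fderiv ℝ f x) (h x) := by
      funext x
      exact B.fderiv_of_bilinear (hf.differentiable (by simp) x) (hh.differentiable (by simp) x)
    rw [e1, e2]
    have dF : ∀ k, ContDiff ℝ ∞ (fderiv ℝ (F k)) := fun k => (hF k).fderiv_right (by simp)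
    have dH : ∀ k, ContDiff ℝ ∞ (fderiv ℝ (H k)) := fun k => (hH k).fderiv_right (by simp)
    have df : ContDiff ℝ ∞ (fderiv ℝ f) := hf.fderiv_right (by simp)
    have dh : ContDiff ℝ ∞ (fderiv ℝ h) := hh.fderiv_right (by simp)
    refine CC.add n (fun k => ?_) (fun k => ?_) ?_ ?_ (ih (B.precompR E) hF dH hf dh h1.pred h2.2)
      (ih (B.precompL E) dF hH df hh h1.2 h2.pred)
    · exact ((B.precompR E).contDiff.comp (hF k)).clm_apply (dH k)
    · exact ((B.precompL E).contDiff.comp (dF k)).clm_apply (hH k)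
    · exact ((B.precompR E).contDiff.comp hf).clm_apply dh
    · exact ((B.precompL E).contDiff.comp df).clm_apply hh

theorem CC.comp (n : ℕ) : ∀ {G G' : Type} [NormedAddCommGroup G] [NormedSpace ℝ G]
    [NormedAddCommGroup G'] [NormedSpace ℝ G']
    {H : ℕ → G → G'} {h : G → G'} {F : ℕ → E → G} {f : E → G}
    (_ : ∀ k, ContDiff ℝ ∞ (H k)) (_ : ∀ k, ContDiff ℝ ∞ (F k))
    (_ : ContDiff ℝ ∞ h) (_ : ContDiff ℝ ∞ f) (_ : CC n H h) (_ : CC n F f),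
    CC n (fun k x => H k (F k x)) (fun x => h (f x)) := by
  have base : ∀ {G G' : Type} [NormedAddCommGroup G] [NormedSpace ℝ G]
    [NormedAddCommGroup G'] [NormedSpace ℝ G']
    {H : ℕ → G → G'} {h : G → G'} {F : ℕ → E → G} {f : E → G}
    (_ : CC 0 H h) (_ : CC 0 F f), CC 0 (fun k x => H k (F k x)) (fun x => h (f x)) := by
    intro G G' _ _ _ _ H h F f h1 h2 x
    exact (h1 (f x)).comp (tendsto_fst.prodMk (h2 x))
  induction n with
  | zero =>
    intro G G' _ _ _ _ H h F f _ _ _ _ h1 h2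
    exact base h1 h2
  | succ n ih =>
    intro G G' _ _ _ _ H h F f hH hF hh hf h1 h2
    refine ⟨base h1.zero' h2.zero', ?_⟩
    have e1 : (fun k => fderiv ℝ (fun x => H k (F k x))) =
        fun k x => ContinuousLinearMap.compL ℝ E G G' (fderiv ℝ (H k) (F k x))
          (fderiv ℝ (F k) x) := by
      funext k x
      exact fderiv_comp x ((hH k).differentiable (by simp) _) ((hF k).differentiable (by simp) x)
    have e2 : fderiv ℝ (fun x => h (f x)) =
        fun x => ContinuousLinearMap.compL ℝ E G G' (fderiv ℝ h (f x)) (fderiv ℝ f x) := by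
      funext x
      exact fderiv_comp x (hh.differentiable (by simp) _) (hf.differentiable (by simp) x)
    rw [e1, e2]
    have dF : ∀ k, ContDiff ℝ ∞ (fderiv ℝ (F k)) := fun k => (hF k).fderiv_right (by simp)
    have dH : ∀ k, ContDiff ℝ ∞ (fderiv ℝ (H k)) := fun k => (hH k).fderiv_right (by simp)
    have df : ContDiff ℝ ∞ (fderiv ℝ f) := hf.fderiv_right (by simp)
    have dh : ContDiff ℝ ∞ (fderiv ℝ h) := hh.fderiv_right (by simp)
    exact CC.bilin n (ContinuousLinearMap.compL ℝ E G G') (fun k => (dH k).comp (hF k)) dF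
      (dh.comp hf) df (ih dH hF dh hf h1.2 h2.pred) h2.2

theorem CC.clm (n : ℕ) {G G' : Type} [NormedAddCommGroup G] [NormedSpace ℝ G]
    [NormedAddCommGroup G'] [NormedSpace ℝ G'] (L : G →L[ℝ] G')
    {F : ℕ → E → G} {f : E → G} (hF : ∀ k, ContDiff ℝ ∞ (F k)) (hf : ContDiff ℝ ∞ f)
    (h : CC n F f) : CC n (fun k x => L (F k x)) (fun x => L (f x)) :=
  CC.comp n (H := fun _ => L) (fun _ => L.contDiff) hF L.contDiff hf (CC.const n L.contDiff) h

theorem CC.prodMk (n : ℕ) {G G' : Type} [NormedAddCommGroup G] [NormedSpace ℝ G]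
    [NormedAddCommGroup G'] [NormedSpace ℝ G']
    {F : ℕ → E → G} {f : E → G} {H : ℕ → E → G'} {h : E → G'}
    (hF : ∀ k, ContDiff ℝ ∞ (F k)) (hf : ContDiff ℝ ∞ f)
    (hH : ∀ k, ContDiff ℝ ∞ (H k)) (hh : ContDiff ℝ ∞ h)
    (h1 : CC n F f) (h2 : CC n H h) : CC n (fun k x => (F k x, H k x)) (fun x => (f x, h x)) := by
  have := CC.add n (fun k => (ContinuousLinearMap.inl ℝ G G').contDiff.comp (hF k))
    (fun k => (ContinuousLinearMap.inr ℝ G G').contDiff.comp (hH k))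
    ((ContinuousLinearMap.inl ℝ G G').contDiff.comp hf)
    ((ContinuousLinearMap.inr ℝ G G').contDiff.comp hh)
    (CC.clm n (ContinuousLinearMap.inl ℝ G G') hF hf h1)
    (CC.clm n (ContinuousLinearMap.inr ℝ G G') hH hh h2)
  simpa using this

theorem CC.param (n : ℕ) {η : ℝ} (hη : 0 < η) {τ : ℕ → ℝ} (hτ : ∀ k, τ k ∈ Ioo (-η) η)
    (hτ0 : Tendsto τ atTop (𝓝 0)) :
    ∀ {G : Type} [NormedAddCommGroup G] [NormedSpace ℝ G]
    {Ψ : ℝ × E → G} (_ : ContDiffOn ℝ ∞ Ψ (Ioo (-η) η ×ˢ univ)),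
    CC n (fun k x => Ψ (τ k, x)) (fun x => Ψ (0, x)) := by
  have hU : IsOpen (Ioo (-η) η ×ˢ (univ : Set E)) := isOpen_Ioo.prod isOpen_univ
  have h0 : (0:ℝ) ∈ Ioo (-η) η := ⟨by linarith, hη⟩
  have base : ∀ {G : Type} [NormedAddCommGroup G] [NormedSpace ℝ G]
    {Ψ : ℝ × E → G} (_ : ContDiffOn ℝ ∞ Ψ (Ioo (-η) η ×ˢ univ)),
    CC 0 (fun k x => Ψ (τ k, x)) (fun x => Ψ (0, x)) := by
    intro G _ _ Ψ h x
    have hc : ContinuousAt Ψ (0, x) := h.continuousOn.continuousAt (hU.mem_nhds ⟨h0, mem_univ _⟩)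
    have : Tendsto (fun z : ℕ × E => (τ z.1, z.2)) (atTop ×ˢ 𝓝 x) (𝓝 ((0:ℝ), x)) :=
      (hτ0.comp tendsto_fst).prodMk_nhds tendsto_snd
    exact hc.tendsto.comp this
  induction n with
  | zero => exact base
  | succ n ih =>
    intro G _ _ Ψ h
    refine ⟨base h, ?_⟩
    have e : ∀ t ∈ Ioo (-η) η, fderiv ℝ (fun x => Ψ (t, x)) =
        fun x => (fderiv ℝ Ψ (t, x)).comp (ContinuousLinearMap.inr ℝ ℝ E) := by
      intro t ht
      funext x
      have h1 : HasFDerivAt Ψ (fderiv ℝ Ψ (t, x)) (t, x) :=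
        ((h.differentiableOn (by simp)).differentiableAt (hU.mem_nhds ⟨ht, mem_univ _⟩)).hasFDerivAt
      exact (h1.comp x (hasFDerivAt_prodMk_right t x)).fderiv
    rw [e 0 h0, funext fun k => e (τ k) (hτ k)]
    apply ih (Ψ := fun z => (fderiv ℝ Ψ z).comp (ContinuousLinearMap.inr ℝ ℝ E))
    exact (h.fderiv_of_isOpen hU (by simp)).clm_comp contDiffOn_const

theorem CC.iter (n : ℕ) : ∀ {G : Type} [NormedAddCommGroup G] [NormedSpace ℝ G]
    {F : ℕ → E → G} {f : E → G}, CC n F f ↔ ∀ j ≤ n, ∀ x, Tendsto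
      (fun z : ℕ × E => iteratedFDeriv ℝ j (F z.1) z.2) (atTop ×ˢ 𝓝 x)
      (𝓝 (iteratedFDeriv ℝ j f x)) := by
  have base : ∀ {G : Type} [NormedAddCommGroup G] [NormedSpace ℝ G]
    {F : ℕ → E → G} {f : E → G}, CC 0 F f ↔ ∀ x, Tendsto
      (fun z : ℕ × E => iteratedFDeriv ℝ 0 (F z.1) z.2) (atTop ×ˢ 𝓝 x)
      (𝓝 (iteratedFDeriv ℝ 0 f x)) := by
    intro G _ _ F f
    refine forall_congr' fun x => ?_
    have := (continuousMultilinearCurryFin0 ℝ E G).symm.toHomeomorph.isInducing.tendsto_nhds_iff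
      (f := fun z : ℕ × E => F z.1 z.2) (l := atTop ×ˢ 𝓝 x) (y := f x)
    exact this
  induction n with
  | zero =>
    intro G _ _ F f
    rw [base]
    constructor
    · intro h j hj
      obtain rfl : j = 0 := by omega
      exact h
    · intro h
      exact h 0 le_rfl
  | succ n ih =>
    intro G _ _ F f
    have hs : CC (n + 1) F f ↔ CC 0 F f ∧ CC n (fun k => fderiv ℝ (F k)) (fderiv ℝ f) := Iff.rfl
    have key : ∀ j x, Tendsto
      (fun z : ℕ × E => iteratedFDeriv ℝ j (fderiv ℝ (F z.1)) z.2) (atTop ×ˢ 𝓝 x)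
      (𝓝 (iteratedFDeriv ℝ j (fderiv ℝ f) x)) ↔ Tendsto
      (fun z : ℕ × E => iteratedFDeriv ℝ (j + 1) (F z.1) z.2) (atTop ×ˢ 𝓝 x)
      (𝓝 (iteratedFDeriv ℝ (j + 1) f x)) := by
      intro j x
      have := (continuousMultilinearCurryRightEquiv' ℝ j E G).symm.toHomeomorph.isInducing.tendsto_nhds_iff
        (f := fun z : ℕ × E => iteratedFDeriv ℝ j (fderiv ℝ (F z.1)) z.2) (l := atTop ×ˢ 𝓝 x)
        (y := iteratedFDeriv ℝ j (fderiv ℝ f) x)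
      rw [this]
      simp only [iteratedFDeriv_succ_eq_comp_right]
      rfl
    rw [hs, ih, base]
    constructor
    · rintro ⟨h1, h2⟩ j hj x
      cases j with
      | zero => exact h1 x
      | succ j => exact (key j x).1 (h2 j (by omega) x)
    · intro h
      exact ⟨h 0 (by omega), fun j hj x => (key j x).2 (h (j + 1) (by omega) x)⟩

theorem CC.of_close {G : Type} [NormedAddCommGroup G] [NormedSpace ℝ G]
    {F : ℕ → E → G} {f : E → G} (hF : ∀ k, ContDiff ℝ ∞ (F k)) (hf : ContDiff ℝ ∞ f)
    (h : ∀ n : ℕ, ∀ j ≤ n, ∀ x, ‖x‖ ≤ n → ‖iteratedFDeriv ℝ j (fun y => F n y - f y) x‖ < 1 / (n + 1))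
    (n : ℕ) : CC n F f := by
  have h1 : CC n (fun k y => F k y - f y) (fun _ => 0) := by
    rw [CC.iter]
    intro j hj x
    have : iteratedFDeriv ℝ j (fun _ : E => (0 : G)) x = 0 := by
      have := iteratedFDeriv_fun_zero (𝕜 := ℝ) (E := E) (F := G) (n := j)
      exact congrFun this x
    rw [this]
    have ht : Tendsto (fun z : ℕ × E => (1:ℝ) / (z.1 + 1)) (atTop ×ˢ 𝓝 x) (𝓝 0) :=
      tendsto_one_div_add_atTop_nhds_zero_nat.comp tendsto_fst
    refine squeeze_zero_norm' ?_ ht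
    obtain ⟨N, hN⟩ := exists_nat_gt (‖x‖ + 1)
    have e1 : ∀ᶠ z : ℕ × E in atTop ×ˢ 𝓝 x, z.1 ≥ max N j :=
      tendsto_fst.eventually (eventually_ge_atTop (max N j))
    have e2 : ∀ᶠ z : ℕ × E in atTop ×ˢ 𝓝 x, z.2 ∈ Metric.ball x 1 :=
      tendsto_snd.eventually (Metric.ball_mem_nhds x one_pos)
    filter_upwards [e1, e2] with z hz1 hz2
    refine (h z.1 j ((le_max_right _ _).trans hz1) z.2 ?_).le
    have h3 : ‖z.2 - x‖ < 1 := mem_ball_iff_norm.1 hz2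
    have h4 : ‖z.2‖ ≤ ‖x‖ + ‖z.2 - x‖ := by simpa using norm_add_le x (z.2 - x)
    have h5 : (N : ℝ) ≤ z.1 := by exact_mod_cast (le_max_left _ _).trans hz1
    linarith
  have := CC.add n (fun k => (hF k).sub hf) (fun _ => hf) contDiff_const hf h1 (CC.const n hf)
  simpa using this

theorem CC.close {G : Type} [NormedAddCommGroup G] [NormedSpace ℝ G]
    {F : ℕ → E → G} {f : E → G} (hF : ∀ k, ContDiff ℝ ∞ (F k)) (hf : ContDiff ℝ ∞ f)
    (n : ℕ) (h : CC n F f) (K : Set E) (hK : IsCompact K) {ε : ℝ} (hε : 0 < ε) :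
    ∀ᶠ k in atTop, ∀ j ≤ n, ∀ x ∈ K, ‖iteratedFDeriv ℝ j (fun y => F k y - f y) x‖ < ε := by
  have h1 : CC n (fun k y => F k y - f y) (fun _ => 0) := by
    have := CC.add n hF (fun _ => hf.neg) hf hf.neg h (CC.const n hf.neg)
    simpa [sub_eq_add_neg] using this
  rw [CC.iter] at h1
  have h2 : ∀ j ∈ Finset.range (n + 1), ∀ᶠ k in atTop, ∀ x ∈ K,
      ‖iteratedFDeriv ℝ j (fun y => F k y - f y) x‖ < ε := by
    intro j hj
    have hj' : j ≤ n := by simpa [Nat.lt_succ_iff] using hj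
    refine hK.induction_on (p := fun s => ∀ᶠ k in atTop, ∀ x ∈ s,
      ‖iteratedFDeriv ℝ j (fun y => F k y - f y) x‖ < ε) (by simp) ?_ ?_ ?_
    · intro s t hst ht
      filter_upwards [ht] with k hk x hx
      exact hk x (hst hx)
    · intro s t hs ht
      filter_upwards [hs, ht] with k hk hk' x hx
      exact hx.elim (hk x) (hk' x)
    intro x hx
    have h3 := h1 j hj' x
    have : iteratedFDeriv ℝ j (fun _ : E => (0 : G)) x = 0 := by
      have := iteratedFDeriv_fun_zero (𝕜 := ℝ) (E := E) (F := G) (n := j)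
      exact congrFun this x
    rw [this] at h3
    have h4 := h3.eventually (Metric.ball_mem_nhds _ hε)
    obtain ⟨pa, ha, pb, hb, hab⟩ := eventually_prod_iff.1 h4
    refine ⟨{y | pb y}, mem_nhdsWithin_of_mem_nhds hb, ?_⟩
    filter_upwards [ha] with k hk y hy
    simpa using hab hk hy
  filter_upwards [(Finset.eventually_all _).2 h2] with k hk j hj x hx
  exact hk j (by simpa [Nat.lt_succ_iff] using hj) x hx

end CCsec


section SRsec
open Set Filter Topology ContDiff

theorem foldl_comp_aux {α : Type*} (l : List (α → α)) : ∀ g : α → α,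
    l.foldl (fun g f => f ∘ g) g = (l.foldl (fun g f => f ∘ g) id) ∘ g := by
  induction l with
  | nil => intro g; rfl
  | cons a l ih =>
    intro g
    simp only [List.foldl_cons]
    rw [ih (a ∘ g), ih (a ∘ id)]
    rfl

theorem Reachable.comp {d : ℕ} {U : Type*} {Ham : U → Phase d → ℝ} {τ₁ τ₂ : ℝ}
    {Φ₁ Φ₂ : Phase d → Phase d} (h₁ : Reachable Ham τ₁ Φ₁) (h₂ : Reachable Ham τ₂ Φ₂) :
    Reachable Ham (τ₁ + τ₂) (Φ₂ ∘ Φ₁) := by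
  obtain ⟨n, a, u, φ, ha, hs, hf, rfl⟩ := h₁
  obtain ⟨m, b, v, ψ, hb, ht, hg, rfl⟩ := h₂
  refine ⟨n + m, Fin.append a b, Fin.append u v, Fin.append φ ψ, ?_, ?_, ?_, ?_⟩
  · intro i
    refine Fin.addCases (fun i => ?_) (fun i => ?_) i
    · simpa using ha i
    · simpa using hb i
  · rw [Fin.sum_univ_add]
    simp [hs, ht]
  · intro i
    refine Fin.addCases (fun i => ?_) (fun i => ?_) i
    · simpa using hf i
    · simpa using hg i
  · have e : (fun i => (Fin.append φ ψ : Fin (n + m) → ℝ → Phase d → Phase d) i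
        (Fin.append a b i)) = Fin.append (fun i => φ i (a i)) (fun i => ψ i (b i)) := by
      funext i
      refine Fin.addCases (fun i => ?_) (fun i => ?_) i <;> simp
    rw [e, List.ofFn_fin_append, List.foldl_append]
    exact (foldl_comp_aux (List.ofFn fun i => ψ i (b i)) _).symm

theorem Reachable.zero {d : ℕ} {U : Type*} (Ham : U → Phase d → ℝ) : Reachable Ham 0 id :=
  ⟨0, Fin.elim0, Fin.elim0, Fin.elim0, fun i => i.elim0, by simp, fun i => i.elim0, by simp⟩

theorem Reachable.single {d : ℕ} {U : Type*} {Ham : U → Phase d → ℝ} (u : U) {τ : ℝ} (hτ : 0 ≤ τ)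
    {φ : ℝ → Phase d → Phase d} (h : IsFlowOf (hamVF (Ham u)) φ) : Reachable Ham τ (φ τ) :=
  ⟨1, fun _ => τ, fun _ => u, fun _ => φ, fun _ => hτ, by simp, fun _ => h, by simp⟩

/-- approximately reachable at times tending to `T`, by smooth reachable maps, sequential form -/
def SRT {d : ℕ} {U : Type*} (Ham : U → Phase d → ℝ) (T : ℝ) (Ψ : Phase d → Phase d) : Prop :=
  ContDiff ℝ ∞ Ψ ∧ ∃ (τ : ℕ → ℝ) (Φ : ℕ → Phase d → Phase d), (∀ k, 0 ≤ τ k) ∧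
    Tendsto τ atTop (𝓝 T) ∧ (∀ k, Reachable Ham (τ k) (Φ k)) ∧ (∀ k, ContDiff ℝ ∞ (Φ k)) ∧
    ∀ n, CC n Φ Ψ

variable {d : ℕ} {U : Type*} {Ham : U → Phase d → ℝ}

theorem SRT.id : SRT Ham 0 (id : Phase d → Phase d) :=
  ⟨contDiff_id, fun _ => 0, fun _ => _root_.id, fun _ => le_rfl, tendsto_const_nhds,
    fun _ => Reachable.zero Ham, fun _ => contDiff_id, fun n => CC.const n contDiff_id⟩

theorem SRT.of_reachable {T : ℝ} {Φ : Phase d → Phase d} (hT : 0 ≤ T) (h : Reachable Ham T Φ)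
    (hs : ContDiff ℝ ∞ Φ) : SRT Ham T Φ :=
  ⟨hs, fun _ => T, fun _ => Φ, fun _ => hT, tendsto_const_nhds,
    fun _ => h, fun _ => hs, fun n => CC.const n hs⟩

theorem SRT.comp {T₁ T₂ : ℝ} {Ψ₁ Ψ₂ : Phase d → Phase d} (h₂ : SRT Ham T₂ Ψ₂) (h₁ : SRT Ham T₁ Ψ₁) :
    SRT Ham (T₁ + T₂) (Ψ₂ ∘ Ψ₁) := by
  obtain ⟨c₁, τ₁, Φ₁, p₁, t₁, r₁, s₁, l₁⟩ := h₁
  obtain ⟨c₂, τ₂, Φ₂, p₂, t₂, r₂, s₂, l₂⟩ := h₂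
  refine ⟨c₂.comp c₁, fun k => τ₁ k + τ₂ k, fun k => Φ₂ k ∘ Φ₁ k, fun k => add_nonneg (p₁ k) (p₂ k),
    t₁.add t₂, fun k => (r₁ k).comp (r₂ k), fun k => (s₂ k).comp (s₁ k), fun n =>
    CC.comp n (H := Φ₂) (F := Φ₁) (h := Ψ₂) (f := Ψ₁) s₂ s₁ c₂ c₁ (l₂ n) (l₁ n)⟩

theorem SRT.comp0 {Ψ₁ Ψ₂ : Phase d → Phase d} (h₂ : SRT Ham 0 Ψ₂) (h₁ : SRT Ham 0 Ψ₁) :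
    SRT Ham 0 (Ψ₂ ∘ Ψ₁) := by
  simpa using h₂.comp h₁

theorem SRT.small {T : ℝ} {Ψ : Phase d → Phase d} (h : SRT Ham T Ψ) {ε : ℝ} (hε : 0 < ε)
    {K : Set (Phase d)} (hK : IsCompact K) (n : ℕ) : ∃ τ Φ, 0 ≤ τ ∧ |τ - T| ≤ ε ∧
      Reachable Ham τ Φ ∧ ContDiff ℝ ∞ Φ ∧ CloseCl n K ε Φ Ψ := by
  obtain ⟨c, τ, Φ, p, t, r, s, l⟩ := h
  have h1 := CC.close s c n (l n) K hK hε
  have h2 : ∀ᶠ k in atTop, |τ k - T| < ε := by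
    have := t.eventually (Metric.ball_mem_nhds T hε)
    simpa [Real.dist_eq] using this
  obtain ⟨k, hk1, hk2⟩ := (h1.and h2).exists
  exact ⟨τ k, Φ k, p k, hk2.le, r k, s k, hk1⟩

theorem SRT.smallTime {Ψ : Phase d → Phase d} (h : SRT Ham 0 Ψ) : SmallTimeReachable Ham Ψ := by
  intro ε hε K hK n
  obtain ⟨τ, Φ, h0, h1, h2, -, h3⟩ := h.small hε hK n
  rw [sub_zero] at h1
  exact ⟨τ, ⟨h0, (le_abs_self _).trans h1⟩, Φ, h2, h3⟩

theorem SRT.limit {T : ℝ} {S : ℕ → ℝ} (hS : Tendsto S atTop (𝓝 T)) {Ψ : Phase d → Phase d}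
    (hΨ : ContDiff ℝ ∞ Ψ) (F : ℕ → Phase d → Phase d)
    (hF : ∀ k, SRT Ham (S k) (F k)) (h : ∀ n, CC n F Ψ) : SRT Ham T Ψ := by
  have hk := fun k : ℕ => (hF k).small (ε := 1 / ((k : ℝ) + 1)) (by positivity)
    (isCompact_closedBall (0 : Phase d) k) k
  choose τ Φ p t r s l using hk
  refine ⟨hΨ, τ, Φ, p, ?_, r, s, fun n => ?_⟩
  · have h1 : Tendsto (fun k => τ k - S k) atTop (𝓝 0) :=
      squeeze_zero_norm t tendsto_one_div_add_atTop_nhds_zero_nat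
    simpa using h1.add hS
  · have h1 : CC n (fun k y => Φ k y - F k y) (fun _ => 0) := by
      refine CC.of_close (fun k => (s k).sub (hF k).1) contDiff_const ?_ n
      intro n j hj x hx
      have := l n j hj x (by simpa using hx)
      simpa using this
    have := CC.add n (fun k => (s k).sub (hF k).1) (fun k => (hF k).1) contDiff_const hΨ h1 (h n)
    simpa using this

/-- families of time-one maps of `τ A + B` depend smoothly on `τ` -/
theorem family_limit {E : Type} [NormedAddCommGroup E] [NormedSpace ℝ E] [CompleteSpace E]
    (A B : E → E) (hA : ContDiff ℝ ∞ A) (hB : ContDiff ℝ ∞ B) (K : NNReal)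
    (LA : LipschitzWith K A) (LB : LipschitzWith (1/4) B) (S : ℝ → E → E) (S0 : E → E)
    (hS : ∀ τ > 0, ∀ x, ∃ γ : ℝ → E, γ 0 = x ∧ γ 1 = S τ x ∧
      ∀ t, HasDerivAt γ (τ • A (γ t) + B (γ t)) t)
    (hS0 : ∀ x, ∃ γ : ℝ → E, γ 0 = x ∧ γ 1 = S0 x ∧ ∀ t, HasDerivAt γ (B (γ t)) t) :
    ∃ η > (0:ℝ), (∀ τ ∈ Ioo 0 η, ContDiff ℝ ∞ (S τ)) ∧ ContDiff ℝ ∞ S0 ∧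
      ∀ τ : ℕ → ℝ, (∀ k, τ k ∈ Ioo 0 η) → Tendsto τ atTop (𝓝 0) →
        ∀ n, CC n (fun k => S (τ k)) S0 := by
  obtain ⟨η, hη, Ψ, hΨ, hγ⟩ := ode_smooth A B hA hB K LA LB
  have e1 : ∀ τ ∈ Ioo 0 η, S τ = fun x => Ψ (τ, x) := by
    intro τ hτ
    funext x
    obtain ⟨γ, h0, h1, h2⟩ := hS τ hτ.1 x
    rw [← h1, hγ τ ⟨by linarith [hτ.1], hτ.2⟩ γ h2, h0]
  have e0 : S0 = fun x => Ψ (0, x) := by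
    funext x
    obtain ⟨γ, h0, h1, h2⟩ := hS0 x
    rw [← h1, hγ 0 ⟨by linarith, hη⟩ γ (fun t => by simpa using h2 t), h0]
  have hs : ∀ τ ∈ Ioo (-η) η, ContDiff ℝ ∞ (fun x => Ψ (τ, x)) := by
    intro τ hτ
    rw [← contDiffOn_univ]
    exact hΨ.comp (contDiff_prodMk_right τ).contDiffOn (fun x _ => ⟨hτ, mem_univ _⟩)
  refine ⟨η, hη, fun τ hτ => ?_, ?_, fun τ hτ ht n => ?_⟩
  · rw [e1 τ hτ]
    exact hs τ ⟨by linarith [hτ.1], hτ.2⟩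
  · rw [e0]
    exact hs 0 ⟨by linarith, hη⟩
  · rw [e0, funext fun k => e1 (τ k) (hτ k)]
    exact CC.param n hη (fun k => ⟨by linarith [(hτ k).1], (hτ k).2⟩) ht hΨ

end SRsec


section HamSec
open Set Filter Topology ContDiff

/-- coordinates of a linear form -/
noncomputable def evv (d : ℕ) : ((Fin d → ℝ) →L[ℝ] ℝ) →L[ℝ] (Fin d → ℝ) :=
  ContinuousLinearMap.pi fun i => ContinuousLinearMap.apply ℝ ℝ (Pi.single i (1:ℝ) : Fin d → ℝ)

@[simp] theorem evv_apply (d : ℕ) (L : (Fin d → ℝ) →L[ℝ] ℝ) (i : Fin d) :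
    evv d L i = L (Pi.single i 1) := rfl

theorem vshear_eq {d : ℕ} (f : (Fin d → ℝ) → ℝ) :
    vshear f = fun x => (x.1, x.2 - evv d (fderiv ℝ f x.1)) := rfl

/-- the Gaussian -/
noncomputable def gau {d : ℕ} (q : Fin d → ℝ) : ℝ := Real.exp (-(∑ i, (q i) ^ 2) / 2)

theorem gau_contDiff {d : ℕ} : ContDiff ℝ ∞ (gau (d := d)) := by
  unfold gau
  fun_prop

theorem gau_hasFDerivAt {d : ℕ} (q : Fin d → ℝ) :
    HasFDerivAt (gau (d := d))
      (∑ j, (-(q j * gau q)) • (ContinuousLinearMap.proj j : (Fin d → ℝ) →L[ℝ] ℝ)) q := by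
  have h1 : ∀ j : Fin d, HasFDerivAt (fun q : Fin d → ℝ => (q j) ^ 2)
      ((2 * q j) • (ContinuousLinearMap.proj j : (Fin d → ℝ) →L[ℝ] ℝ)) q := by
    intro j
    have := (hasFDerivAt_apply (𝕜 := ℝ) j q).pow 2
    simpa using this
  have h2 := (HasFDerivAt.fun_sum (u := Finset.univ) fun j _ => h1 j)
  have h3 := ((h2.neg).mul_const (1/2 : ℝ)).exp
  have e : (fun x : Fin d → ℝ => Real.exp ((-fun x => ∑ i, x i ^ 2) x * (1 / 2))) = gau := by
    funext x
    simp [gau]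
    ring_nf
  rw [show (fun x : Fin d → ℝ => Real.exp ((-fun x => ∑ i, x i ^ 2) x * (1 / 2))) = gau from e] at h3
  refine h3.congr_fderiv ?_
  ext v
  have e2 : Real.exp ((-fun x : Fin d → ℝ => ∑ i, x i ^ 2) q * (1 / 2)) = gau q := congrFun e q
  rw [e2]
  simp [Finset.mul_sum]
  refine Finset.sum_congr rfl fun i _ => ?_
  ring

/-- the gradient of the Gaussian -/
noncomputable def gG {d : ℕ} (q : Fin d → ℝ) : Fin d → ℝ := fun i => -(q i * gau q)

theorem evv_gau {d : ℕ} (q : Fin d → ℝ) : evv d (fderiv ℝ gau q) = gG q := by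
  funext i
  rw [(gau_hasFDerivAt q).fderiv]
  simp [gG, Pi.single_apply]

theorem gG_contDiff {d : ℕ} : ContDiff ℝ ∞ (gG (d := d)) := by
  rw [contDiff_pi]
  intro i
  exact ((contDiff_apply ℝ ℝ i).mul gau_contDiff).neg

theorem gG_lip {d : ℕ} : LipschitzWith (1 + 2 * d) (gG (d := d)) := by
  refine LipschitzWith.of_dist_le_mul fun x y => ?_
  rw [dist_pi_le_iff (by positivity)]
  intro i
  have hd : ∀ q : Fin d → ℝ, HasFDerivAt (fun q : Fin d → ℝ => gG q i)
      (-((q i) • (∑ j, (-(q j * gau q)) • (ContinuousLinearMap.proj j : (Fin d → ℝ) →L[ℝ] ℝ)) +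
        (gau q) • (ContinuousLinearMap.proj i : (Fin d → ℝ) →L[ℝ] ℝ))) q := fun q =>
    ((hasFDerivAt_apply (𝕜 := ℝ) i q).mul (gau_hasFDerivAt q)).neg
  have hb : ∀ q : Fin d → ℝ, ‖(-((q i) • (∑ j, (-(q j * gau q)) •
      (ContinuousLinearMap.proj j : (Fin d → ℝ) →L[ℝ] ℝ)) +
        (gau q) • (ContinuousLinearMap.proj i : (Fin d → ℝ) →L[ℝ] ℝ)))‖ ≤ 1 + 2 * d := by
    intro q
    refine ContinuousLinearMap.opNorm_le_bound _ (by positivity) fun v => ?_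
    have hg0 : 0 < gau q := Real.exp_pos _
    have hS0 : 0 ≤ ∑ i, (q i) ^ 2 := Finset.sum_nonneg fun i _ => sq_nonneg _
    have hg1 : gau q ≤ 1 := by
      unfold gau
      rw [Real.exp_le_one_iff]
      linarith
    have hg2 : (∑ i, (q i) ^ 2) * gau q ≤ 2 := by
      have h1 := Real.add_one_le_exp ((∑ i, (q i) ^ 2) / 2)
      have h2 : gau q * Real.exp ((∑ i, (q i) ^ 2) / 2) = 1 := by
        unfold gau
        rw [← Real.exp_add, neg_div, neg_add_cancel, Real.exp_zero]
      nlinarith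
    have hq : ∀ j, |q i * (q j * gau q)| ≤ 2 := by
      intro j
      have h1 : |q i * q j| ≤ ∑ i, (q i) ^ 2 := by
        have hi := Finset.single_le_sum (f := fun i => (q i)^2) (fun i _ => sq_nonneg _) (Finset.mem_univ i)
        have hj := Finset.single_le_sum (f := fun i => (q i)^2) (fun i _ => sq_nonneg _) (Finset.mem_univ j)
        rw [abs_le]
        constructor <;> nlinarith [sq_nonneg (q i - q j), sq_nonneg (q i + q j)]
      rw [← mul_assoc, abs_mul, abs_of_pos hg0]
      nlinarith
    have e : (-((q i) • (∑ j, (-(q j * gau q)) •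
      (ContinuousLinearMap.proj j : (Fin d → ℝ) →L[ℝ] ℝ)) +
        (gau q) • (ContinuousLinearMap.proj i : (Fin d → ℝ) →L[ℝ] ℝ))) v
        = (∑ j, q i * (q j * gau q) * v j) - gau q * v i := by
      simp [Finset.mul_sum]
      ring_nf
    rw [e]
    have hv : ∀ j, |v j| ≤ ‖v‖ := fun j => norm_le_pi_norm v j
    have s1 : ‖∑ j, q i * (q j * gau q) * v j‖ ≤ ∑ j : Fin d, 2 * ‖v‖ := by
      refine norm_sum_le_of_le _ fun j _ => ?_
      rw [norm_mul]
      exact mul_le_mul (hq j) (hv j) (norm_nonneg _) (by norm_num)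
    have s2 : ‖gau q * v i‖ ≤ 1 * ‖v‖ := by
      rw [norm_mul, Real.norm_of_nonneg hg0.le]
      exact mul_le_mul hg1 (hv i) (norm_nonneg _) (by norm_num)
    have s3 := norm_sub_le (∑ j, q i * (q j * gau q) * v j) (gau q * v i)
    rw [Finset.sum_const, Finset.card_univ, Fintype.card_fin, nsmul_eq_mul] at s1
    nlinarith
  have := convex_univ.norm_image_sub_le_of_norm_hasFDerivWithin_le
    (f := fun q : Fin d → ℝ => gG q i) (fun q _ => (hd q).hasFDerivWithinAt) (fun q _ => hb q)
    (mem_univ y) (mem_univ x)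
  rw [dist_eq_norm, dist_eq_norm]
  push_cast
  exact this

theorem hamVF_euc {d : ℕ} (V0 : (Fin d → ℝ) → ℝ) (hV0 : ContDiff ℝ ∞ V0) (u : (Fin d → ℝ) × ℝ)
    (x : Phase d) : hamVF (eucHam V0 u) x =
      (x.2, -(evv d (fderiv ℝ V0 x.1) + u.1 + u.2 • gG x.1)) := by
  have h1 : ∀ j : Fin d, HasFDerivAt (fun x : Phase d => (x.2 j) ^ 2)
      ((2 * x.2 j) • ((ContinuousLinearMap.proj j : (Fin d → ℝ) →L[ℝ] ℝ).comp
        (ContinuousLinearMap.snd ℝ _ _))) x := by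
    intro j
    have := (((hasFDerivAt_apply (𝕜 := ℝ) j x.2).comp x hasFDerivAt_snd)).pow 2
    simpa using this
  have h2 : HasFDerivAt (fun x : Phase d => (∑ i, (x.2 i) ^ 2) / 2) _ x :=
    (HasFDerivAt.fun_sum (u := Finset.univ) fun j _ => h1 j).mul_const (2⁻¹ : ℝ)
  have h3 : HasFDerivAt (fun x : Phase d => V0 x.1) _ x :=
    ((hV0.differentiable (by simp) x.1).hasFDerivAt).comp x hasFDerivAt_fst
  have h4 : HasFDerivAt (fun x : Phase d => ∑ j, u.1 j * x.1 j) _ x :=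
    HasFDerivAt.fun_sum (u := Finset.univ) fun j _ =>
      ((hasFDerivAt_apply (𝕜 := ℝ) j x.1).comp x hasFDerivAt_fst).const_mul (u.1 j)
  have h5 : HasFDerivAt (fun x : Phase d => gau x.1) _ x :=
    (gau_hasFDerivAt x.1).comp x hasFDerivAt_fst
  have h6 : HasFDerivAt (eucHam V0 u) _ x := ((h2.add h3).add h4).add (h5.const_mul u.2)
  unfold hamVF
  rw [h6.fderiv]
  ext i
  · simp [Pi.single_apply]
  · simp [Pi.single_apply, gG]

/-- drift field -/
noncomputable def fA {d : ℕ} (V0 : (Fin d → ℝ) → ℝ) (x : Phase d) : Phase d :=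
  (x.2, -evv d (fderiv ℝ V0 x.1))

/-- control field -/
noncomputable def fB {d : ℕ} (b : Fin d → ℝ) (c : ℝ) (x : Phase d) : Phase d :=
  (0, -(b + c • gG x.1))

theorem fA_contDiff {d : ℕ} {V0 : (Fin d → ℝ) → ℝ} (hV0 : ContDiff ℝ ∞ V0) :
    ContDiff ℝ ∞ (fA V0) := by
  refine contDiff_snd.prodMk ?_
  exact ((evv d).contDiff.comp ((hV0.fderiv_right (by simp)).comp contDiff_fst)).neg

theorem fB_contDiff {d : ℕ} (b : Fin d → ℝ) (c : ℝ) : ContDiff ℝ ∞ (fB b c) := by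
  refine contDiff_const.prodMk ?_
  exact (contDiff_const.add ((gG_contDiff.comp contDiff_fst).const_smul c)).neg

theorem fA_lip {d : ℕ} {V0 : (Fin d → ℝ) → ℝ} (hLip : ∃ L : NNReal, LipschitzWith L (fderiv ℝ V0)) :
    ∃ K, LipschitzWith K (fA V0) := by
  obtain ⟨L, hL⟩ := hLip
  refine ⟨_, LipschitzWith.prodMk LipschitzWith.prod_snd
    (((evv d).lipschitz.comp (hL.comp LipschitzWith.prod_fst)).neg)⟩

theorem fB_lip {d : ℕ} (b : Fin d → ℝ) (c : ℝ) : LipschitzWith (‖c‖₊ * (1 + 2 * d)) (fB b c) := by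
  refine LipschitzWith.of_dist_le_mul fun x y => ?_
  have h := (gG_lip (d := d)).dist_le_mul x.1 y.1
  rw [dist_eq_norm] at h ⊢
  have e : fB b c x - fB b c y = (0, -(c • (gG x.1 - gG y.1))) := by
    simp only [fB]
    ext i <;> simp
    ring
  rw [e, Prod.norm_def]
  simp only [norm_zero, norm_neg, norm_smul]
  rw [max_eq_right (by positivity)]
  push_cast at h ⊢
  rw [mul_assoc]
  gcongr
  refine h.trans ?_
  gcongr
  rw [dist_eq_norm, dist_eq_norm]
  exact norm_fst_le (x - y)

theorem euc_flow {d : ℕ} {V0 : (Fin d → ℝ) → ℝ} (hV0 : ContDiff ℝ ∞ V0)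
    (hLip : ∃ L : NNReal, LipschitzWith L (fderiv ℝ V0)) (u : (Fin d → ℝ) × ℝ) :
    ∃ φ, IsFlowOf (hamVF (eucHam V0 u)) φ := by
  obtain ⟨K, hK⟩ := fA_lip hLip
  have e : hamVF (eucHam V0 u) = fun x => fA V0 x + fB u.1 u.2 x := by
    funext x
    rw [hamVF_euc V0 hV0]
    simp only [fA, fB, Prod.mk_add_mk, add_zero]
    rw [neg_add, neg_add, neg_add, add_assoc]
  have h := aux_global_flow (hamVF (eucHam V0 u))
    (by rw [e]; exact ((fA_contDiff hV0).add (fB_contDiff _ _)).of_le (by simp)) (K + _)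
    (by rw [e]; exact hK.add (fB_lip _ _))
  choose φ h0 h1 using h
  exact ⟨fun t x => φ x t, h0, h1⟩

end HamSec


section BaseSec
open Set Filter Topology ContDiff

variable {d : ℕ} {V0 : (Fin d → ℝ) → ℝ}

theorem base_family (hV0 : ContDiff ℝ ∞ V0)
    (hLip : ∃ L : NNReal, LipschitzWith L (fderiv ℝ V0)) (b : Fin d → ℝ) (c : ℝ)
    (hc : ‖c‖₊ * (1 + 2 * d) ≤ 1 / 4) (φ : ℝ → ℝ → Phase d → Phase d)
    (hφ : ∀ τ, IsFlowOf (hamVF (eucHam V0 (τ⁻¹ • b, τ⁻¹ * c))) (φ τ)) :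
    ∃ η > (0:ℝ), (∀ τ ∈ Ioo 0 η, ContDiff ℝ ∞ (φ τ τ)) ∧
      ContDiff ℝ ∞ (fun x : Phase d => (x.1, x.2 - (b + c • gG x.1))) ∧
      ∀ τ : ℕ → ℝ, (∀ k, τ k ∈ Ioo 0 η) → Tendsto τ atTop (𝓝 0) →
        ∀ n, CC n (fun k => φ (τ k) (τ k)) (fun x : Phase d => (x.1, x.2 - (b + c • gG x.1))) := by
  obtain ⟨K, hK⟩ := fA_lip hLip
  refine family_limit (fA V0) (fB b c) (fA_contDiff hV0) (fB_contDiff b c) K hK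
    ((fB_lip b c).weaken hc) (fun τ => φ τ τ) _ ?_ ?_
  · intro τ hτ x
    refine ⟨fun s => φ τ (τ * s) x, by simpa using (hφ τ).1 x, by simp, fun t => ?_⟩
    have h1 := (hφ τ).2 x (τ * t)
    have h2 : HasDerivAt (fun s : ℝ => τ * s) τ t := by
      simpa using (hasDerivAt_id t).const_mul τ
    have h3 := HasDerivAt.scomp t h1 h2
    refine h3.congr_deriv ?_
    rw [hamVF_euc V0 hV0]
    simp only [fA, fB]
    ext i
    · simp
    · simp
      field_simp
      ring
  · intro x
    refine ⟨fun s => (x.1, x.2 - s • (b + c • gG x.1)), by simp, by simp, fun t => ?_⟩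
    simp only [fB]
    refine (hasDerivAt_const t x.1).prodMk ?_
    have h1 : HasDerivAt (fun s : ℝ => s • (b + c • gG x.1)) ((1:ℝ) • (b + c • gG x.1)) t :=
      (hasDerivAt_id t).smul_const _
    simpa using h1.const_sub x.2

theorem sr_small (hV0 : ContDiff ℝ ∞ V0)
    (hLip : ∃ L : NNReal, LipschitzWith L (fderiv ℝ V0)) (b : Fin d → ℝ) (c : ℝ)
    (hc : ‖c‖₊ * (1 + 2 * d) ≤ 1 / 4) :
    SRT (eucHam V0) 0 (fun x : Phase d => (x.1, x.2 - (b + c • gG x.1))) := by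
  choose φ hφ using fun τ : ℝ => euc_flow hV0 hLip (τ⁻¹ • b, τ⁻¹ * c)
  obtain ⟨η, hη, h1, h2, h3⟩ := base_family hV0 hLip b c hc φ hφ
  have ht : Tendsto (fun k : ℕ => η / 2 * (1 / ((k : ℝ) + 1))) atTop (𝓝 0) := by
    simpa using tendsto_one_div_add_atTop_nhds_zero_nat.const_mul (η / 2)
  have hm : ∀ k : ℕ, η / 2 * (1 / ((k : ℝ) + 1)) ∈ Ioo 0 η := by
    intro k
    refine ⟨by positivity, ?_⟩
    have : 1 / ((k : ℝ) + 1) ≤ 1 := by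
      rw [div_le_one (by positivity)]
      linarith [k.cast_nonneg (α := ℝ)]
    nlinarith
  exact ⟨h2, _, _, fun k => (hm k).1.le, ht, fun k => Reachable.single _ (hm k).1.le (hφ _),
    fun k => h1 _ (hm k), h3 _ hm ht⟩

theorem sr_ptrans (hV0 : ContDiff ℝ ∞ V0)
    (hLip : ∃ L : NNReal, LipschitzWith L (fderiv ℝ V0)) (b : Fin d → ℝ) :
    SRT (eucHam V0) 0 (fun x : Phase d => (x.1, x.2 + b)) := by
  have := sr_small hV0 hLip (-b) 0 (by simp)
  simpa using this

theorem sr_gau (hV0 : ContDiff ℝ ∞ V0)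
    (hLip : ∃ L : NNReal, LipschitzWith L (fderiv ℝ V0)) (c : ℝ) :
    SRT (eucHam V0) 0 (fun x : Phase d => (x.1, x.2 - c • gG x.1)) := by
  obtain ⟨N, hN⟩ := exists_nat_gt (‖c‖ * (1 + 2 * d) * 4)
  have hN0 : (0:ℝ) < N := lt_of_le_of_lt (by positivity) hN
  have h1 : SRT (eucHam V0) 0 (fun x : Phase d => (x.1, x.2 - (c / N) • gG x.1)) := by
    have := sr_small hV0 hLip 0 (c / N) (by
      rw [← NNReal.coe_le_coe]
      push_cast
      rw [norm_div, Real.norm_natCast]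
      have e : ‖c‖ / N * (1 + 2 * d) = (‖c‖ * (1 + 2 * d)) / N := by ring
      rw [e, div_le_iff₀ hN0]
      linarith)
    simpa using this
  have h2 : ∀ m : ℕ, SRT (eucHam V0) 0 (fun x : Phase d => (x.1, x.2 - (m * (c / N)) • gG x.1)) := by
    intro m
    induction m with
    | zero => simpa [_root_.id, Function.id_def] using (SRT.id (Ham := eucHam V0))
    | succ m ih =>
      have := h1.comp0 ih
      convert this using 1
      funext x
      ext i <;> simp
      ring
  have := h2 N
  rwa [mul_div_cancel₀ _ hN0.ne'] at this

theorem sr_qtrans (hV0 : ContDiff ℝ ∞ V0)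
    (hLip : ∃ L : NNReal, LipschitzWith L (fderiv ℝ V0)) (a : Fin d → ℝ) :
    SRT (eucHam V0) 0 (fun x : Phase d => (x.1 + a, x.2)) := by
  obtain ⟨φ, hφ⟩ := euc_flow hV0 hLip (0, 0)
  obtain ⟨η, hη, h1, -, -⟩ := base_family hV0 hLip 0 0 (by simp) (fun _ => φ)
    (fun τ => by simpa using hφ)
  have hfree : ∀ τ ∈ Ioo 0 η, SRT (eucHam V0) τ (φ τ) := fun τ hτ =>
    SRT.of_reachable hτ.1.le (Reachable.single _ hτ.1.le hφ) (h1 τ hτ)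
  set S : ℝ → Phase d → Phase d := fun τ => (fun x : Phase d => (x.1, x.2 + -(τ⁻¹ • a))) ∘ φ τ ∘
    (fun x : Phase d => (x.1, x.2 + τ⁻¹ • a)) with hSdef
  have hS : ∀ τ ∈ Ioo 0 η, SRT (eucHam V0) τ (S τ) := by
    intro τ hτ
    have := (sr_ptrans hV0 hLip (-(τ⁻¹ • a))).comp
      ((hfree τ hτ).comp (sr_ptrans hV0 hLip (τ⁻¹ • a)))
    simpa using this
  obtain ⟨K, hK⟩ := fA_lip hLip
  obtain ⟨η', hη', h1', h2', h3'⟩ := family_limit (fA V0) (fun _ => (a, 0)) (fA_contDiff hV0)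
    contDiff_const K hK ((LipschitzWith.const _).weaken (by simp)) S
    (fun x : Phase d => (x.1 + a, x.2)) (by
      intro τ hτ x
      refine ⟨fun s => ((φ (τ * s) (x.1, x.2 + τ⁻¹ • a)).1,
        (φ (τ * s) (x.1, x.2 + τ⁻¹ • a)).2 + -(τ⁻¹ • a)), ?_, ?_, fun t => ?_⟩
      · simp [hφ.1]
      · simp [hSdef]
      · have h1 := hφ.2 (x.1, x.2 + τ⁻¹ • a) (τ * t)
        have h2 : HasDerivAt (fun s : ℝ => τ * s) τ t := by
          simpa using (hasDerivAt_id t).const_mul τ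
        have h3 := HasDerivAt.scomp t h1 h2
        have h4 := h3.add_const ((0 : Fin d → ℝ), -(τ⁻¹ • a))
        have e : (fun s => ((φ (τ * s) (x.1, x.2 + τ⁻¹ • a)).1,
          (φ (τ * s) (x.1, x.2 + τ⁻¹ • a)).2 + -(τ⁻¹ • a))) =
          fun s => ((fun s => φ s (x.1, x.2 + τ⁻¹ • a)) ∘ fun s => τ * s) s
            + ((0 : Fin d → ℝ), -(τ⁻¹ • a)) := by
          funext s
          ext i <;> simp
        rw [e]
        refine h4.congr_deriv ?_
        rw [hamVF_euc V0 hV0]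
        simp only [fA]
        ext i
        · simp
          field_simp
          ring
        · simp) (by
      intro x
      refine ⟨fun s => (x.1 + s • a, x.2), by simp, by simp, fun t => ?_⟩
      refine HasDerivAt.prodMk ?_ (hasDerivAt_const t x.2)
      have h1 : HasDerivAt (fun s : ℝ => s • a) ((1:ℝ) • a) t := (hasDerivAt_id t).smul_const _
      simpa using h1.const_add x.1)
  set ρ := min η η' with hρ
  have hρ0 : 0 < ρ := lt_min hη hη'
  have ht : Tendsto (fun k : ℕ => ρ / 2 * (1 / ((k : ℝ) + 1))) atTop (𝓝 0) := by
    simpa using tendsto_one_div_add_atTop_nhds_zero_nat.const_mul (ρ / 2)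
  have hm : ∀ k : ℕ, ρ / 2 * (1 / ((k : ℝ) + 1)) ∈ Ioo 0 ρ := by
    intro k
    refine ⟨by positivity, ?_⟩
    have : 1 / ((k : ℝ) + 1) ≤ 1 := by
      rw [div_le_one (by positivity)]
      linarith [k.cast_nonneg (α := ℝ)]
    nlinarith
  exact SRT.limit ht h2' _ (fun k => hS _ ⟨(hm k).1, (hm k).2.trans_le (min_le_left _ _)⟩)
    (h3' _ (fun k => ⟨(hm k).1, (hm k).2.trans_le (min_le_right _ _)⟩) ht)

theorem fderiv_gau_shift (a q : Fin d → ℝ) :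
    evv d (fderiv ℝ (fun q => gau (q - a)) q) = gG (q - a) := by
  have h := (gau_hasFDerivAt (q - a)).comp q ((hasFDerivAt_id q).sub_const a)
  have h2 : fderiv ℝ (fun q => gau (q - a)) q = fderiv ℝ gau (q - a) := by
    rw [(gau_hasFDerivAt (q - a)).fderiv]
    exact h.fderiv
  rw [h2, evv_gau]

theorem vshear_gau (hV0 : ContDiff ℝ ∞ V0)
    (hLip : ∃ L : NNReal, LipschitzWith L (fderiv ℝ V0)) (a : Fin d → ℝ) (c : ℝ) :
    SRT (eucHam V0) 0 (vshear (fun q => c * gau (q - a))) := by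
  have := (sr_qtrans hV0 hLip a).comp0 ((sr_gau hV0 hLip c).comp0 (sr_qtrans hV0 hLip (-a)))
  convert this using 1
  rw [vshear_eq]
  funext x
  have hd : DifferentiableAt ℝ (fun q : Fin d → ℝ => gau (q - a)) x.1 :=
    (gau_contDiff.comp (contDiff_id.sub contDiff_const)).differentiable (by simp) x.1
  have e : fderiv ℝ (fun q : Fin d → ℝ => c * gau (q - a)) x.1
      = c • fderiv ℝ (fun q : Fin d → ℝ => gau (q - a)) x.1 := fderiv_const_mul hd c
  rw [e, map_smul, fderiv_gau_shift]
  ext i <;> simp [sub_eq_add_neg]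

theorem vshear_add (f g : (Fin d → ℝ) → ℝ) (hf : ContDiff ℝ ∞ f) (hg : ContDiff ℝ ∞ g) :
    vshear (fun q => f q + g q) = vshear f ∘ vshear g := by
  simp only [vshear_eq]
  funext x
  have e : fderiv ℝ (fun q => f q + g q) x.1 = fderiv ℝ f x.1 + fderiv ℝ g x.1 :=
    fderiv_fun_add (hf.differentiable (by simp) _) (hg.differentiable (by simp) _)
  simp only [e, map_add, Function.comp]
  ext i <;> simp
  ring

/-- exponential sums -/
inductive ExpSum {d : ℕ} : ((Fin d → ℝ) → ℝ) → Prop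
  | zero : ExpSum (fun _ => 0)
  | add (a : Fin d → ℝ) (c : ℝ) (f : (Fin d → ℝ) → ℝ) (hf : ExpSum f) :
    ExpSum (fun q => c * Real.exp (∑ i, a i * q i) + f q)

theorem ExpSum.contDiff {f : (Fin d → ℝ) → ℝ} (h : ExpSum f) : ContDiff ℝ ∞ f := by
  induction h with
  | zero => exact contDiff_const
  | add a c f hf ih => fun_prop

theorem vshear_expSum (hV0 : ContDiff ℝ ∞ V0)
    (hLip : ∃ L : NNReal, LipschitzWith L (fderiv ℝ V0)) {f : (Fin d → ℝ) → ℝ} (h : ExpSum f) :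
    SRT (eucHam V0) 0 (vshear (fun q => gau q * f q)) := by
  induction h with
  | zero =>
    have := SRT.id (Ham := eucHam V0)
    convert this using 1
    rw [vshear_eq]
    funext x
    ext i <;> simp
  | add a c f hf ih =>
    have h1 := vshear_gau hV0 hLip a (c * Real.exp ((∑ i, (a i) ^ 2) / 2))
    have e : (fun q : Fin d → ℝ => gau q * (c * Real.exp (∑ i, a i * q i) + f q)) =
        fun q => c * Real.exp ((∑ i, (a i) ^ 2) / 2) * gau (q - a) + gau q * f q := by
      funext q
      have : gau q * Real.exp (∑ i, a i * q i) =
          Real.exp ((∑ i, (a i) ^ 2) / 2) * gau (q - a) := by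
        unfold gau
        rw [← Real.exp_add, ← Real.exp_add]
        congr 1
        have : ∑ i, ((q - a) i) ^ 2 = ∑ i, (q i)^2 + ∑ i, (a i)^2 - 2 * ∑ i, a i * q i := by
          rw [Finset.mul_sum, ← Finset.sum_add_distrib, ← Finset.sum_sub_distrib]
          refine Finset.sum_congr rfl fun i _ => ?_
          simp only [Pi.sub_apply]
          ring
        rw [this]
        ring
      linear_combination c * this
    rw [e, vshear_add _ _ _ (gau_contDiff.mul hf.contDiff)]
    · exact h1.comp0 ih
    · exact contDiff_const.mul (gau_contDiff.comp (contDiff_id.sub contDiff_const))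

/-- reduction to density of exponential sums -/
theorem vshear_of_density (hV0 : ContDiff ℝ ∞ V0)
    (hLip : ∃ L : NNReal, LipschitzWith L (fderiv ℝ V0)) {f : (Fin d → ℝ) → ℝ}
    (hf : ContDiff ℝ ∞ f) (P : ℕ → (Fin d → ℝ) → ℝ) (hP : ∀ k, ExpSum (P k))
    (hPf : ∀ n, CC n P (fun q => (gau q)⁻¹ * f q)) : SRT (eucHam V0) 0 (vshear f) := by
  have hg0 : ∀ q : Fin d → ℝ, gau q ≠ 0 := fun q => (Real.exp_pos _).ne'
  have hgf : ContDiff ℝ ∞ (fun q => (gau q)⁻¹ * f q) := (gau_contDiff.inv hg0).mul hf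
  have h1 : ∀ n, CC n (fun k q => gau q * P k q) f := by
    intro n
    have := CC.bilin n (ContinuousLinearMap.mul ℝ ℝ) (F := fun _ => gau) (H := P)
      (fun _ => gau_contDiff) (fun k => (hP k).contDiff) gau_contDiff hgf
      (CC.const n gau_contDiff) (hPf n)
    simpa [hg0] using this
  have hs : ∀ k, ContDiff ℝ ∞ (fun q => gau q * P k q) := fun k =>
    gau_contDiff.mul (hP k).contDiff
  have h2 : ∀ n, CC n (fun k => fderiv ℝ (fun q => gau q * P k q)) (fderiv ℝ f) := fun n =>
    (h1 (n + 1)).2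
  have ds : ∀ k, ContDiff ℝ ∞ (fderiv ℝ (fun q => gau q * P k q)) := fun k =>
    (hs k).fderiv_right (by simp)
  have df : ContDiff ℝ ∞ (fderiv ℝ f) := hf.fderiv_right (by simp)
  have hev : ∀ n, CC n (fun k (x : Phase d) => (-evv d) (fderiv ℝ (fun q => gau q * P k q) x.1))
      (fun x : Phase d => (-evv d) (fderiv ℝ f x.1)) := fun n =>
    CC.clm n (-evv d) (F := fun k (x : Phase d) => fderiv ℝ (fun q => gau q * P k q) x.1)
      (fun k => (ds k).comp contDiff_fst) (df.comp contDiff_fst)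
      (CC.comp n (F := fun _ (x : Phase d) => x.1) (f := fun x : Phase d => x.1) ds
        (fun _ => contDiff_fst) df contDiff_fst (h2 n) (CC.const n contDiff_fst))
  have sev : ∀ k, ContDiff ℝ ∞
      (fun (x : Phase d) => (-evv d) (fderiv ℝ (fun q => gau q * P k q) x.1)) := fun k =>
    (-evv d).contDiff.comp ((ds k).comp contDiff_fst)
  have sef : ContDiff ℝ ∞ (fun (x : Phase d) => (-evv d) (fderiv ℝ f x.1)) :=
    (-evv d).contDiff.comp (df.comp contDiff_fst)
  have h3 : ∀ n, CC n (fun k => vshear (fun q => gau q * P k q)) (vshear f) := by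
    intro n
    have := CC.prodMk n (F := fun _ (x : Phase d) => x.1) (fun _ => contDiff_fst) contDiff_fst
      (fun k => contDiff_snd.add (sev k)) (contDiff_snd.add sef) (CC.const n contDiff_fst)
      (CC.add n (F := fun _ (x : Phase d) => x.2) (fun _ => contDiff_snd) sev contDiff_snd sef
        (CC.const n contDiff_snd) (hev n))
    simpa [vshear_eq, sub_eq_add_neg] using this
  refine SRT.limit tendsto_const_nhds ?_ _ (fun k => vshear_expSum hV0 hLip (hP k)) h3
  have := contDiff_fst.prodMk (contDiff_snd.add sef)
  simpa [vshear_eq, sub_eq_add_neg] using this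

end BaseSec


section DensSec
open Set Filter Topology ContDiff Convolution ContinuousLinearMap

theorem moll_CC {d : ℕ} (φ : ℕ → ContDiffBump (0 : Fin d → ℝ))
    (hφ : Tendsto (fun k => (φ k).rOut) atTop (𝓝 0)) (n : ℕ) :
    ∀ {G : Type} [NormedAddCommGroup G] [NormedSpace ℝ G] [CompleteSpace G]
    {g : (Fin d → ℝ) → G} (_ : ContDiff ℝ ∞ g) (_ : HasCompactSupport g),
    CC n (fun k => ((φ k).normed volume ⋆[lsmul ℝ ℝ, volume] g)) g := by
  have base : ∀ {G : Type} [NormedAddCommGroup G] [NormedSpace ℝ G] [CompleteSpace G]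
    {g : (Fin d → ℝ) → G} (_ : ContDiff ℝ ∞ g) (_ : HasCompactSupport g),
    CC 0 (fun k => ((φ k).normed volume ⋆[lsmul ℝ ℝ, volume] g)) g := by
    intro G _ _ _ g hg hc x
    exact ContDiffBump.convolution_tendsto_right (μ := volume) (ι := ℕ × (Fin d → ℝ))
      (φ := fun z => φ z.1) (g := fun _ => g) (k := fun z => z.2) (x₀ := x) (z₀ := g x)
      (hφ.comp tendsto_fst) (Eventually.of_forall fun _ => hg.continuous.aestronglyMeasurable)
      ((hg.continuous.tendsto x).comp tendsto_snd) tendsto_snd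
  induction n with
  | zero => exact base
  | succ n ih =>
    intro G _ _ _ g hg hc
    refine ⟨base hg hc, ?_⟩
    have e : ∀ k, fderiv ℝ ((φ k).normed volume ⋆[lsmul ℝ ℝ, volume] g) =
        ((φ k).normed volume ⋆[lsmul ℝ ℝ, volume] (fderiv ℝ g)) := by
      intro k
      funext x
      have h1 := hc.hasFDerivAt_convolution_right (lsmul ℝ ℝ) (μ := volume)
        ((φ k).continuous_normed (μ := volume)).locallyIntegrable (hg.of_le (by simp)) x
      rw [h1.fderiv]
      rfl
    rw [funext e]
    exact ih (hg.fderiv_right (by simp)) (hc.fderiv ℝ)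

theorem conv_CC {d : ℕ} {P : ℕ → (Fin d → ℝ) → ℝ} {g : (Fin d → ℝ) → ℝ}
    (hP : ∀ k, Continuous (P k)) (hg : Continuous g) (hc : HasCompactSupport g)
    (hPg : ∀ k : ℕ, ∀ x, ‖x‖ ≤ k → ‖P k x - g x‖ < 1 / ((k : ℝ) + 1)) (n : ℕ) :
    ∀ {F F' : Type} [NormedAddCommGroup F] [NormedSpace ℝ F] [NormedAddCommGroup F']
    [NormedSpace ℝ F'] [CompleteSpace F']
    (L : F →L[ℝ] ℝ →L[ℝ] F') {ρ : (Fin d → ℝ) → F} (_ : ContDiff ℝ ∞ ρ) (_ : HasCompactSupport ρ),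
    CC n (fun k => (ρ ⋆[L, volume] P k)) (ρ ⋆[L, volume] g) := by
  obtain ⟨M, hM⟩ := hc.exists_bound_of_continuous hg
  have hPg0 : CC 0 P g := by
    intro x
    have h1 : Tendsto (fun z : ℕ × (Fin d → ℝ) => P z.1 z.2 - g z.2) (atTop ×ˢ 𝓝 x) (𝓝 0) := by
      have ht : Tendsto (fun z : ℕ × (Fin d → ℝ) => (1:ℝ) / (z.1 + 1)) (atTop ×ˢ 𝓝 x) (𝓝 0) :=
        tendsto_one_div_add_atTop_nhds_zero_nat.comp tendsto_fst
      refine squeeze_zero_norm' ?_ ht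
      obtain ⟨N, hN⟩ := exists_nat_gt (‖x‖ + 1)
      have e1 : ∀ᶠ z : ℕ × (Fin d → ℝ) in atTop ×ˢ 𝓝 x, z.1 ≥ N :=
        tendsto_fst.eventually (eventually_ge_atTop N)
      have e2 : ∀ᶠ z : ℕ × (Fin d → ℝ) in atTop ×ˢ 𝓝 x, z.2 ∈ Metric.ball x 1 :=
        tendsto_snd.eventually (Metric.ball_mem_nhds x one_pos)
      filter_upwards [e1, e2] with z hz1 hz2
      refine (hPg z.1 z.2 ?_).le
      have h3 : ‖z.2 - x‖ < 1 := mem_ball_iff_norm.1 hz2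
      have h4 : ‖z.2‖ ≤ ‖x‖ + ‖z.2 - x‖ := by simpa using norm_add_le x (z.2 - x)
      have h5 : (N : ℝ) ≤ z.1 := by exact_mod_cast hz1
      linarith
    have h2 := h1.add ((hg.tendsto x).comp tendsto_snd)
    simpa using h2
  have base : ∀ {F F' : Type} [NormedAddCommGroup F] [NormedSpace ℝ F] [NormedAddCommGroup F']
    [NormedSpace ℝ F'] [CompleteSpace F']
    (L : F →L[ℝ] ℝ →L[ℝ] F') {ρ : (Fin d → ℝ) → F} (_ : ContDiff ℝ ∞ ρ) (_ : HasCompactSupport ρ),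
    CC 0 (fun k => (ρ ⋆[L, volume] P k)) (ρ ⋆[L, volume] g) := by
    intro F F' _ _ _ _ _ L ρ hρ hcρ x
    obtain ⟨R, hR⟩ := hcρ.isCompact.isBounded.subset_closedBall (0 : Fin d → ℝ)
    simp only [convolution_def]
    refine tendsto_integral_filter_of_dominated_convergence (fun t => ‖L‖ * ‖ρ t‖ * (M + 1))
      ?_ ?_ ?_ ?_
    · refine Eventually.of_forall fun z => Continuous.aestronglyMeasurable ?_
      have := hP z.1
      have := hρ.continuous
      exact (L.continuous.comp hρ.continuous).clm_apply ((hP z.1).comp (continuous_const.sub continuous_id))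
    · obtain ⟨N, hN⟩ := exists_nat_gt (‖x‖ + 1 + R)
      have e1 : ∀ᶠ z : ℕ × (Fin d → ℝ) in atTop ×ˢ 𝓝 x, z.1 ≥ N :=
        tendsto_fst.eventually (eventually_ge_atTop N)
      have e2 : ∀ᶠ z : ℕ × (Fin d → ℝ) in atTop ×ˢ 𝓝 x, z.2 ∈ Metric.ball x 1 :=
        tendsto_snd.eventually (Metric.ball_mem_nhds x one_pos)
      filter_upwards [e1, e2] with z hz1 hz2
      refine Eventually.of_forall fun t => ?_
      by_cases ht : ρ t = 0
      · simp [ht]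
      · have htR : ‖t‖ ≤ R := by simpa using hR (subset_tsupport _ ht)
        have h3 : ‖z.2 - x‖ < 1 := mem_ball_iff_norm.1 hz2
        have h4 : ‖z.2‖ ≤ ‖x‖ + ‖z.2 - x‖ := by simpa using norm_add_le x (z.2 - x)
        have h5 : (N : ℝ) ≤ z.1 := by exact_mod_cast hz1
        have h6 := norm_sub_le z.2 t
        have h7 := hPg z.1 (z.2 - t) (by linarith)
        have h8 : (1:ℝ) / (z.1 + 1) ≤ 1 := by
          rw [div_le_one (by positivity)]
          linarith [(z.1).cast_nonneg (α := ℝ)]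
        have h9 : ‖P z.1 (z.2 - t)‖ ≤ M + 1 := by
          have := norm_add_le (P z.1 (z.2 - t) - g (z.2 - t)) (g (z.2 - t))
          rw [sub_add_cancel] at this
          linarith [hM (z.2 - t)]
        exact (L.le_opNorm₂ _ _).trans (by gcongr)
    · have : Continuous (fun t => ‖L‖ * ‖ρ t‖ * (M + 1)) := by
        have := hρ.continuous
        fun_prop
      refine this.integrable_of_hasCompactSupport ?_
      refine hcρ.mono ?_
      intro t ht
      simp at ht ⊢
      exact ht.1.2
    · refine Eventually.of_forall fun t => ?_
      have h1 : Tendsto (fun z : ℕ × (Fin d → ℝ) => (z.1, z.2 - t)) (atTop ×ˢ 𝓝 x)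
          (atTop ×ˢ 𝓝 (x - t)) :=
        tendsto_fst.prodMk ((tendsto_id.sub_const t).comp tendsto_snd)
      have h2 := (hPg0 (x - t)).comp h1
      exact ((L (ρ t)).continuous.tendsto _).comp h2
  induction n with
  | zero => exact base
  | succ n ih =>
    intro F F' _ _ _ _ _ L ρ hρ hcρ
    refine ⟨base L hρ hcρ, ?_⟩
    have e : ∀ P : (Fin d → ℝ) → ℝ, Continuous P → fderiv ℝ (ρ ⋆[L, volume] P) =
        (fderiv ℝ ρ ⋆[L.precompL (Fin d → ℝ), volume] P) := by
      intro P hP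
      funext x
      exact (hcρ.hasFDerivAt_convolution_left L (μ := volume) (hρ.of_le (by simp))
        hP.locallyIntegrable x).fderiv
    rw [e g hg, funext fun k => e (P k) (hP k)]
    exact ih _ (hρ.fderiv_right (by simp)) (hcρ.fderiv ℝ)

variable {d : ℕ}

theorem ExpSum.add' {f g : (Fin d → ℝ) → ℝ} (hf : ExpSum f) (hg : ExpSum g) :
    ExpSum (fun q => f q + g q) := by
  induction hf with
  | zero => simpa using hg
  | add a c f hf ih =>
    have := ExpSum.add a c _ ih
    simpa [add_assoc] using this

theorem ExpSum.mul_exp {f : (Fin d → ℝ) → ℝ} (hf : ExpSum f) (b : Fin d → ℝ) (c : ℝ) :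
    ExpSum (fun q => c * Real.exp (∑ i, b i * q i) * f q) := by
  induction hf with
  | zero => simpa using ExpSum.zero
  | add a c' f hf ih =>
    have := ExpSum.add (b + a) (c * c') _ ih
    convert this using 1
    funext q
    simp only [Pi.add_apply, add_mul, Finset.sum_add_distrib, Real.exp_add]
    ring

theorem ExpSum.mul' {f g : (Fin d → ℝ) → ℝ} (hf : ExpSum f) (hg : ExpSum g) :
    ExpSum (fun q => f q * g q) := by
  induction hf with
  | zero => simpa using ExpSum.zero
  | add a c f hf ih =>
    have := (hg.mul_exp a c).add' ih
    simpa [add_mul] using this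

theorem ExpSum.const (c : ℝ) : ExpSum (fun _ : Fin d → ℝ => c) := by
  have := ExpSum.add (0 : Fin d → ℝ) c _ ExpSum.zero
  simpa using this

theorem ExpSum.exp1 (a : Fin d → ℝ) : ExpSum (fun q => Real.exp (∑ i, a i * q i)) := by
  have := ExpSum.add a 1 _ ExpSum.zero
  simpa using this

theorem ExpSum.conv {f : (Fin d → ℝ) → ℝ} (hf : ExpSum f) {ρ : (Fin d → ℝ) → ℝ}
    (hρ : Continuous ρ) (hc : HasCompactSupport ρ) :
    ExpSum (ρ ⋆[lsmul ℝ ℝ, volume] f) := by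
  induction hf with
  | zero =>
    have : (ρ ⋆[lsmul ℝ ℝ, volume] (fun _ : Fin d → ℝ => (0:ℝ))) = fun _ => 0 := by
      funext x
      simp [convolution_def]
    rw [this]
    exact ExpSum.zero
  | add a c f hf ih =>
    have := ExpSum.add a (c * ∫ t, ρ t * Real.exp (-∑ i, a i * t i)) _ ih
    convert this using 1
    funext x
    have h1 : Continuous (fun q : Fin d → ℝ => c * Real.exp (∑ i, a i * q i)) := by fun_prop
    have e := (hc.convolutionExists_left (lsmul ℝ ℝ) (μ := volume) hρ h1.locallyIntegrable).distrib_add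
      (hc.convolutionExists_left (lsmul ℝ ℝ) (μ := volume) hρ
        hf.contDiff.continuous.locallyIntegrable)
    have e' := congrFun e x
    refine e'.trans ?_
    simp only [Pi.add_apply]
    congr 1
    simp only [convolution_def, lsmul_apply, smul_eq_mul]
    rw [← integral_const_mul, ← integral_mul_const]
    congr 1
    funext t
    have : Real.exp (∑ i, a i * (x - t) i) =
        Real.exp (-∑ i, a i * t i) * Real.exp (∑ i, a i * x i) := by
      rw [← Real.exp_add]
      congr 1
      simp [mul_sub, Finset.sum_sub_distrib]
      ring
    rw [this]
    ring

/-- the algebra of exponential sums -/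
noncomputable def expAlg (d : ℕ) : Subalgebra ℝ C(Fin d → ℝ, ℝ) where
  carrier := {f | ExpSum (f : (Fin d → ℝ) → ℝ)}
  mul_mem' := fun hf hg => ExpSum.mul' hf hg
  add_mem' := fun hf hg => ExpSum.add' hf hg
  algebraMap_mem' := fun c => ExpSum.const c

theorem expSum_near {g : (Fin d → ℝ) → ℝ} (hg : Continuous g) {K : Set (Fin d → ℝ)}
    (hK : IsCompact K) {ε : ℝ} (hε : 0 < ε) : ∃ P, ExpSum P ∧ ∀ x ∈ K, ‖P x - g x‖ < ε := by
  have hsep : (expAlg d).SeparatesPoints := by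
    intro x y hxy
    obtain ⟨i, hi⟩ := Function.ne_iff.1 hxy
    have hE := ExpSum.exp1 (Pi.single i (1:ℝ) : Fin d → ℝ)
    refine ⟨_, ⟨⟨_, hE.contDiff.continuous⟩, hE, rfl⟩, ?_⟩
    simp [Pi.single_apply, hi]
  obtain ⟨P, hP, h⟩ := ContinuousMap.exists_mem_subalgebra_near_continuous_of_isCompact_of_separatesPoints
    hsep ⟨g, hg⟩ hK hε
  exact ⟨P, hP, h⟩

/-- limits of exponential sums -/
def Dens (g : (Fin d → ℝ) → ℝ) : Prop :=
  ContDiff ℝ ∞ g ∧ ∃ P : ℕ → (Fin d → ℝ) → ℝ, (∀ k, ExpSum (P k)) ∧ ∀ n, CC n P g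

theorem Dens.limit {g : (Fin d → ℝ) → ℝ} (hg : ContDiff ℝ ∞ g) (F : ℕ → (Fin d → ℝ) → ℝ)
    (hF : ∀ k, Dens (F k)) (h : ∀ n, CC n F g) : Dens g := by
  have hk : ∀ k : ℕ, ∃ P : (Fin d → ℝ) → ℝ, ExpSum P ∧ ∀ j ≤ k, ∀ x ∈ Metric.closedBall 0 (k : ℝ),
      ‖iteratedFDeriv ℝ j (fun y => P y - F k y) x‖ < 1 / ((k : ℝ) + 1) := by
    intro k
    obtain ⟨c, P, hP, hl⟩ := hF k
    obtain ⟨m, hm⟩ := (CC.close (fun k => (hP k).contDiff) c k (hl k) _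
      (isCompact_closedBall (0 : Fin d → ℝ) k) (ε := 1 / ((k : ℝ) + 1)) (by positivity)).exists
    exact ⟨P m, hP m, hm⟩
  choose P hP l using hk
  refine ⟨hg, P, hP, fun n => ?_⟩
  have s := fun k => (hP k).contDiff
  have h1 : CC n (fun k y => P k y - F k y) (fun _ => 0) := by
    refine CC.of_close (fun k => (s k).sub (hF k).1) contDiff_const ?_ n
    intro n j hj x hx
    have := l n j hj x (by simpa using hx)
    simpa using this
  have := CC.add n (fun k => (s k).sub (hF k).1) (fun k => (hF k).1) contDiff_const hg h1 (h n)
  simpa using this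

theorem dens_conv {g : (Fin d → ℝ) → ℝ} (hg : Continuous g) (hc : HasCompactSupport g)
    {ρ : (Fin d → ℝ) → ℝ} (hρ : ContDiff ℝ ∞ ρ) (hcρ : HasCompactSupport ρ) :
    Dens (ρ ⋆[lsmul ℝ ℝ, volume] g) := by
  have hk := fun k : ℕ => expSum_near hg (isCompact_closedBall (0 : Fin d → ℝ) k)
    (ε := 1 / ((k : ℝ) + 1)) (by positivity)
  choose P hP h using hk
  refine ⟨?_, fun k => (ρ ⋆[lsmul ℝ ℝ, volume] P k), fun k => (hP k).conv hρ.continuous hcρ,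
    fun n => ?_⟩
  · exact hcρ.contDiff_convolution_left (lsmul ℝ ℝ) (n := ⊤) hρ hg.locallyIntegrable
  · exact conv_CC (fun k => (hP k).contDiff.continuous) hg hc
      (fun k x hx => h k x (by simpa using hx)) n _ hρ hcρ

theorem dens_compact {g : (Fin d → ℝ) → ℝ} (hg : ContDiff ℝ ∞ g) (hc : HasCompactSupport g) :
    Dens g := by
  set φ : ℕ → ContDiffBump (0 : Fin d → ℝ) := fun k =>
    ⟨1 / ((k : ℝ) + 1), 2 * (1 / ((k : ℝ) + 1)), by positivity, by
      have : 0 < 1 / ((k : ℝ) + 1) := by positivity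
      linarith⟩ with hφ
  refine Dens.limit hg _ (fun k => dens_conv hg.continuous hc ((φ k).contDiff_normed (μ := volume))
    (φ k).hasCompactSupport_normed) (fun n => moll_CC φ ?_ n hg hc)
  have ht : Tendsto (fun k : ℕ => (2:ℝ) * (1 / ((k : ℝ) + 1))) atTop (𝓝 0) := by
    simpa using (tendsto_one_div_add_atTop_nhds_zero_nat (𝕜 := ℝ)).const_mul 2
  exact ht

theorem dens_all {g : (Fin d → ℝ) → ℝ} (hg : ContDiff ℝ ∞ g) : Dens g := by
  set χ : ℕ → ContDiffBump (0 : Fin d → ℝ) := fun k =>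
    ⟨(k : ℝ) + 1, (k : ℝ) + 2, by positivity, by linarith⟩ with hχ
  have hs : ∀ k, ContDiff ℝ ∞ (fun q => χ k q * g q) := fun k => (χ k).contDiff.mul hg
  refine Dens.limit hg (fun k q => χ k q * g q) (fun k => dens_compact (hs k)
    ((χ k).hasCompactSupport.mul_right)) (CC.of_close hs hg ?_)
  intro n j hj x hx
  have e : (fun y => χ n y * g y - g y) =ᶠ[𝓝 x] fun _ => 0 := by
    have : Metric.ball (0 : Fin d → ℝ) (n + 1) ∈ 𝓝 x :=
      Metric.isOpen_ball.mem_nhds (by simp; linarith)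
    filter_upwards [this] with y hy
    rw [(χ n).one_of_mem_closedBall (Metric.ball_subset_closedBall hy)]
    ring
  have h2 := (e.iteratedFDeriv ℝ j).eq_of_nhds
  rw [h2, show iteratedFDeriv ℝ j (fun _ : Fin d → ℝ => (0 : ℝ)) x = 0 from
    congrFun (iteratedFDeriv_fun_zero (𝕜 := ℝ) (E := Fin d → ℝ) (F := ℝ) (n := j)) x, norm_zero]
  positivity

end DensSec

/-- **Theorem (vertical shears on `T*ℝ^d` are small-time approximately reachable).**
For the Euclidean control system `H_u(q,p) = |p|²/2 + V_0(q) + Σ_{j=1}^d u_j q_j +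
u_{d+1} e^{−|q|²/2}` with `V_0` smooth with globally Lipschitz gradient, every vertical
shear `(q,p) ↦ (q, p − ∇f(q))`, `f ∈ C^∞(ℝ^d,ℝ)`, is small-time approximately reachable. -/
theorem euclidean_vertical_shears_reachable
    (d : ℕ) (V0 : (Fin d → ℝ) → ℝ) (hV0 : ContDiff ℝ (⊤ : ℕ∞) V0)
    (hLip : ∃ L : NNReal, LipschitzWith L (fderiv ℝ V0)) :
    ∀ f : (Fin d → ℝ) → ℝ, ContDiff ℝ (⊤ : ℕ∞) f →
      SmallTimeReachable (eucHam V0) (vshear f) := by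
  intro f hf
  have hg : ContDiff ℝ (⊤ : ℕ∞) (fun q => (gau q)⁻¹ * f q) :=
    (gau_contDiff.inv (fun q => (Real.exp_pos _).ne')).mul hf
  obtain ⟨-, P, hP, h⟩ := dens_all hg
  exact (vshear_of_density hV0 hLip hf P hP h).smallTime
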